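/- arXiv:1405.2527 — 7 statements merged into one kernel-verified Lean document; each statement's English description precedes it below -/
import Mathlib

section
/- Let K be a compact Hausdorff space, μ a Radon probability measure on K, and 𝒜 a finite subalgebra of Bor(K). Then every finitely additive probability measure ν on the algebra 𝒜 ⊗ 𝒜 with marginals μ (i.e. ν(A×K) = ν(K×A) = μ(A) for every A ∈ 𝒜) can be extended to a finitely additive probability measure ν̂ on the rectangle algebra 𝓡 = Bor(K) ⊗ Bor(K) with marginals μ (i.e. ν̂(B×K) = ν̂(K×B) = μ(B) for every Borel B ⊆ K). -/
open MeasureTheory Set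

noncomputable section

/-- A topological space has *countable tightness* if whenever `x` lies in the closure of a
set `A`, there is a countable `B ⊆ A` with `x` in the closure of `B`. -/
def CountablyTight (X : Type*) [TopologicalSpace X] : Prop :=
  ∀ (A : Set X) (x : X), x ∈ closure A →
    ∃ B ⊆ A, B.Countable ∧ x ∈ closure B

/-- `P(K)`: the space of Radon probability measures on `K`, i.e. Borel probability
measures which are inner regular with respect to compact sets. -/
def RadonProb (K : Type*) [TopologicalSpace K] : Type _ :=
  { μ : @Measure K (borel K) //
      @IsProbabilityMeasure K (borel K) μ ∧ @Measure.InnerRegular K (borel K) _ μ }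

/-- The weak* topology on `RadonProb K`: the coarsest topology making
`μ ↦ ∫ g dμ` continuous for every continuous `g : K → ℝ`. -/
instance (K : Type*) [TopologicalSpace K] : TopologicalSpace (RadonProb K) :=
  TopologicalSpace.induced
    (fun (μ : RadonProb K) (g : C(K, ℝ)) => ∫ x, g x ∂μ.1) inferInstance

/-- A measure has *countable (Maharam) type* if there is a countable family `𝒞` of measurable
sets such that every measurable set can be approximated in measure by members of `𝒞`. -/
def HasCountableType {K : Type*} {m : MeasurableSpace K} (μ : Measure K) : Prop :=
  ∃ 𝒞 : Set (Set K), 𝒞.Countable ∧ (∀ C ∈ 𝒞, MeasurableSet C) ∧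
    ∀ B : Set K, MeasurableSet B → ∀ ε : ENNReal, 0 < ε → ∃ C ∈ 𝒞, μ (symmDiff B C) < ε

/-- The *Maharam type* of a measure: the least cardinality of a family `𝒞` of measurable sets
such that every measurable set can be approximated in measure by members of `𝒞`. -/
def maharamType {K : Type*} {m : MeasurableSpace K} (μ : Measure K) : Cardinal :=
  sInf {κ : Cardinal | ∃ 𝒞 : Set (Set K), Cardinal.mk 𝒞 = κ ∧ (∀ C ∈ 𝒞, MeasurableSet C) ∧
    ∀ B : Set K, MeasurableSet B → ∀ ε : ENNReal, 0 < ε → ∃ C ∈ 𝒞, μ (symmDiff B C) < ε}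

/-- `μ` is homogeneous of Maharam type `ω₁`: its Maharam type is `ℵ₁` and the Maharam type of
its restriction to every measurable set of positive measure is `ℵ₁`. -/
def IsHomogeneousOmega1 {K : Type*} {m : MeasurableSpace K} (μ : Measure K) : Prop :=
  maharamType μ = Cardinal.aleph 1 ∧
    ∀ B : Set K, MeasurableSet B → 0 < μ B →
      maharamType (μ.restrict B) = Cardinal.aleph 1

/-- A finitely additive probability measure on an algebra `𝒮` of subsets. -/
def IsFinAddProb {α : Type*} (𝒮 : Set (Set α)) (ν : Set α → ℝ) : Prop :=
  (∀ S ∈ 𝒮, 0 ≤ ν S) ∧ ν Set.univ = 1 ∧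
    ∀ S ∈ 𝒮, ∀ T ∈ 𝒮, Disjoint S T → ν (S ∪ T) = ν S + ν T

/-- `𝒜 ⊗ ℬ`: the algebra of subsets of `K × K` generated by rectangles `A ×ˢ B` with
`A ∈ 𝒜`, `B ∈ ℬ`. -/
def prodAlg {K : Type*} (𝒜 ℬ : Set (Set K)) : Set (Set (K × K)) :=
  MeasureTheory.generateSetAlgebra {S | ∃ A ∈ 𝒜, ∃ B ∈ ℬ, S = A ×ˢ B}

/-- The rectangle algebra `𝓡 = Bor(K) ⊗ Bor(K)` on `K × K`. -/
def rectAlgebra (K : Type*) [TopologicalSpace K] : Set (Set (K × K)) :=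
  prodAlg {B : Set K | MeasurableSet[borel K] B} {B : Set K | MeasurableSet[borel K] B}

/-- `ν` (a set function on `K × K`) has both marginals equal to `μ`. -/
def HasMarginals {K : Type*} [TopologicalSpace K] (ν : Set (K × K) → ℝ)
    (μ : @Measure K (borel K)) : Prop :=
  ∀ B : Set K, MeasurableSet[borel K] B →
    ν (B ×ˢ (Set.univ : Set K)) = (μ B).toReal ∧
    ν ((Set.univ : Set K) ×ˢ B) = (μ B).toReal

/-- Finite convex combinations of members of a set of Radon probability measures. -/
def ConvexCombinations {X : Type*} [TopologicalSpace X] (N : Set (RadonProb X)) :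
    Set (RadonProb X) :=
  {ν | ∃ (n : ℕ) (t : Fin n → NNReal) (μs : Fin n → RadonProb X),
      (∀ i, μs i ∈ N) ∧ (∑ i, t i) = 1 ∧ ν.1 = ∑ i, ((t i : ENNReal) • (μs i).1)}

/-- Property (C) of Corson: every family of closed convex sets with the countable
intersection property has nonempty intersection. -/
def PropertyC (X : Type*) [NormedAddCommGroup X] [NormedSpace ℝ X] : Prop :=
  ∀ 𝒞 : Set (Set X), (∀ C ∈ 𝒞, IsClosed C ∧ Convex ℝ C) →
    (∀ 𝒟 ⊆ 𝒞, 𝒟.Countable → (⋂₀ 𝒟).Nonempty) → (⋂₀ 𝒞).Nonempty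

/-- Finite unions of closed rectangles in `K × K`. -/
def closedRectUnions (K : Type*) [TopologicalSpace K] : Set (Set (K × K)) :=
  {L | ∃ (n : ℕ) (F F' : Fin n → Set K), (∀ i, IsClosed (F i)) ∧ (∀ i, IsClosed (F' i)) ∧
    L = ⋃ i, F i ×ˢ F' i}

theorem finAdd_decomp {α ι : Type*} [Fintype ι] {𝒮 : Set (Set α)} (h𝒮 : IsSetAlgebra 𝒮)
    {ν : Set α → ℝ} (hν : IsFinAddProb 𝒮 ν) (f : α → ι) (hf : ∀ i, f ⁻¹' {i} ∈ 𝒮)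
    {S : Set α} (hS : S ∈ 𝒮) : ν S = ∑ i, ν (S ∩ f ⁻¹' {i}) := by
  classical
  obtain ⟨-, -, hadd⟩ := hν
  have h0 : ν ∅ = 0 := by
    have := hadd ∅ h𝒮.empty_mem ∅ h𝒮.empty_mem (by simp)
    simp only [Set.union_self] at this
    linarith
  have key : ∀ s : Finset ι, S ∩ f ⁻¹' (s : Set ι) ∈ 𝒮 ∧
      ν (S ∩ f ⁻¹' (s : Set ι)) = ∑ i ∈ s, ν (S ∩ f ⁻¹' {i}) := by
    intro s
    induction s using Finset.induction_on with
    | empty => simp [h0, h𝒮.empty_mem]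
    | insert a s ha ih =>
      have e : S ∩ f ⁻¹' ((insert a s : Finset ι) : Set ι)
          = (S ∩ f ⁻¹' {a}) ∪ (S ∩ f ⁻¹' (s : Set ι)) := by
        ext x; simp; tauto
      have ha' := h𝒮.inter_mem hS (hf a)
      rw [e, Finset.sum_insert ha]
      refine ⟨h𝒮.union_mem ha' ih.1, ?_⟩
      rw [hadd _ ha' _ ih.1, ih.2]
      rw [Set.disjoint_left]
      rintro x ⟨_, hx⟩ ⟨_, hx'⟩
      simp only [Set.mem_preimage, Set.mem_singleton_iff] at hx
      simp only [Set.mem_preimage, hx] at hx'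
      exact ha (by exact_mod_cast hx')
  have := (key Finset.univ).2
  simpa using this

theorem finAdd_mono {α : Type*} {𝒮 : Set (Set α)} (h𝒮 : IsSetAlgebra 𝒮)
    {ν : Set α → ℝ} (hν : IsFinAddProb 𝒮 ν) {S T : Set α} (hS : S ∈ 𝒮) (hT : T ∈ 𝒮)
    (h : S ⊆ T) : ν S ≤ ν T := by
  have hd := h𝒮.sdiff_mem hT hS
  have := hν.2.2 S hS (T \ S) hd Set.disjoint_sdiff_right
  rw [Set.union_sdiff_cancel h] at this
  have := hν.1 _ hd
  linarith

/-- Every finitely additive probability measure on `𝒜 ⊗ 𝒜`, `𝒜` a finite subalgebra of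
`Bor(K)`, with marginals `μ`, extends to a finitely additive probability measure on the full
rectangle algebra `𝓡 = Bor(K) ⊗ Bor(K)` with marginals `μ`. -/
theorem stmt10 (K : Type*) [TopologicalSpace K] [CompactSpace K] [T2Space K]
    (μ : RadonProb K) (𝒜 : Set (Set K)) (h𝒜 : MeasureTheory.IsSetAlgebra 𝒜)
    (h𝒜f : 𝒜.Finite) (h𝒜m : ∀ A ∈ 𝒜, MeasurableSet[borel K] A)
    (ν : Set (K × K) → ℝ) (hν : IsFinAddProb (prodAlg 𝒜 𝒜) ν)
    (hmarg : ∀ A ∈ 𝒜, ν (A ×ˢ (Set.univ : Set K)) = (μ.1 A).toReal ∧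
      ν ((Set.univ : Set K) ×ˢ A) = (μ.1 A).toReal) :
    ∃ ν' : Set (K × K) → ℝ, IsFinAddProb (rectAlgebra K) ν' ∧ HasMarginals ν' μ.1 ∧
      ∀ S ∈ prodAlg 𝒜 𝒜, ν' S = ν S := by
  classical
  let : MeasurableSpace K := borel K
  obtain ⟨μ, hμ⟩ := μ
  have : IsProbabilityMeasure μ := hμ.1
  simp only at hmarg ⊢
  have hP : IsSetAlgebra (prodAlg 𝒜 𝒜) := isSetAlgebra_generateSetAlgebra
  have hrect : ∀ A ∈ 𝒜, ∀ B ∈ 𝒜, A ×ˢ B ∈ prodAlg 𝒜 𝒜 := fun A hA B hB =>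
    self_subset_generateSetAlgebra ⟨A, hA, B, hB, rfl⟩
  have hν0 : ν ∅ = 0 := by
    have := hν.2.2 ∅ hP.empty_mem ∅ hP.empty_mem (by simp)
    simp only [Set.union_self] at this
    linarith
  have : Finite 𝒜 := h𝒜f
  have : Fintype (Set 𝒜) := Fintype.ofFinite _
  have : Fintype 𝒜 := Fintype.ofFinite _
  have huniv : (Set.univ : Set K) ∈ 𝒜 := h𝒜.univ_mem
  -- the partition into atoms
  let f : K → Set 𝒜 := fun x => {A | x ∈ A.1}
  let P : Set 𝒜 → Set K := fun i => f ⁻¹' {i}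
  have hPA : ∀ i, P i ∈ 𝒜 := by
    intro i
    have e : P i = ⋂ A ∈ (Finset.univ : Finset 𝒜), if A ∈ i then A.1 else A.1ᶜ := by
      ext x
      simp only [P, f, Set.mem_preimage, Set.mem_singleton_iff, Set.mem_iInter, Set.ext_iff,
        Set.mem_ofPred_eq, Finset.mem_univ, true_imp_iff]
      refine forall_congr' fun A => ?_
      split_ifs with h <;> simp [h]
    rw [e]
    refine h𝒜.biInter_mem _ fun A _ => ?_
    split_ifs
    · exact A.2
    · exact h𝒜.compl_mem A.2
  have hPm : ∀ i, MeasurableSet (P i) := fun i => h𝒜m _ (hPA i)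
  have hPdich : ∀ A ∈ 𝒜, ∀ i, ∀ x ∈ P i, ∀ y ∈ P i, (x ∈ A ↔ y ∈ A) := by
    intro A hA i x hx y hy
    have hxy : f x = f y := by
      simp only [P, Set.mem_preimage, Set.mem_singleton_iff] at hx hy
      rw [hx, hy]
    exact (Set.ext_iff.1 hxy ⟨A, hA⟩)
  have hSdich : ∀ S ∈ prodAlg 𝒜 𝒜, ∀ i j, ∀ x ∈ P i ×ˢ P j, ∀ y ∈ P i ×ˢ P j,
      (x ∈ S ↔ y ∈ S) := by
    intro S hS i j x hx y hy
    induction hS with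
    | base S h =>
      obtain ⟨A, hA, B, hB, rfl⟩ := h
      have h1 := hPdich A hA i _ hx.1 _ hy.1
      have h2 := hPdich B hB j _ hx.2 _ hy.2
      simp only [Set.mem_prod, h1, h2]
    | empty => simp
    | compl S _ ih => simp only [Set.mem_compl_iff, ih]
    | union S T _ _ ih1 ih2 => simp only [Set.mem_union, ih1, ih2]
  let π : Measure (K × K) := μ.prod μ
  let c : Set 𝒜 → Set 𝒜 → ℝ := fun i j => ν (P i ×ˢ P j) / (μ.real (P i) * μ.real (P j))
  let ν' : Set (K × K) → ℝ := fun S => ∑ i, ∑ j, c i j * π.real (S ∩ P i ×ˢ P j)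
  have hQ0 : ∀ i j, 0 ≤ ν (P i ×ˢ P j) := fun i j => hν.1 _ (hrect _ (hPA i) _ (hPA j))
  have hQ1 : ∀ i j, μ.real (P i) = 0 → ν (P i ×ˢ P j) = 0 := by
    intro i j h
    refine le_antisymm ?_ (hQ0 i j)
    rw [← h, measureReal_def, ← (hmarg _ (hPA i)).1]
    exact finAdd_mono hP hν (hrect _ (hPA i) _ (hPA j)) (hrect _ (hPA i) _ huniv)
      (Set.prod_mono subset_rfl (Set.subset_univ _))
  have hQ2 : ∀ i j, μ.real (P j) = 0 → ν (P i ×ˢ P j) = 0 := by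
    intro i j h
    refine le_antisymm ?_ (hQ0 i j)
    rw [← h, measureReal_def, ← (hmarg _ (hPA j)).2]
    exact finAdd_mono hP hν (hrect _ (hPA i) _ (hPA j)) (hrect _ huniv _ (hPA j))
      (Set.prod_mono (Set.subset_univ _) subset_rfl)
  have hsum1 : ∀ i, ∑ j, ν (P i ×ˢ P j) = μ.real (P i) := by
    intro i
    rw [measureReal_def, ← (hmarg _ (hPA i)).1,
      finAdd_decomp hP hν (fun p : K × K => f p.2) (fun j => ?_) (hrect _ (hPA i) _ huniv)]
    · refine Finset.sum_congr rfl fun j _ => ?_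
      congr 1
      ext x
      simp [P]
    · convert hrect _ huniv _ (hPA j) using 1
      ext x
      simp [P]
  have hsum2 : ∀ j, ∑ i, ν (P i ×ˢ P j) = μ.real (P j) := by
    intro j
    rw [measureReal_def, ← (hmarg _ (hPA j)).2,
      finAdd_decomp hP hν (fun p : K × K => f p.1) (fun i => ?_) (hrect _ huniv _ (hPA j))]
    · refine Finset.sum_congr rfl fun i _ => ?_
      congr 1
      ext x
      simp [P, and_comm]
    · convert hrect _ (hPA i) _ huniv using 1
      ext x
      simp [P]
  have hdecμ : ∀ B : Set K, MeasurableSet B → μ.real B = ∑ i, μ.real (B ∩ P i) := by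
    intro B hB
    have hal : IsSetAlgebra {B : Set K | MeasurableSet B} :=
      { empty_mem := by simp
        compl_mem := fun _ h => by simpa using h
        union_mem := fun _ _ h h' => by
          simp only [Set.mem_ofPred_eq] at h h' ⊢
          exact h.union h' }
    exact finAdd_decomp (ν := μ.real) hal
      ⟨fun _ _ => measureReal_nonneg, by simp, fun S _ T hT hd => measureReal_union hd (by simpa using hT)⟩
      f (fun i => by simpa using hPm i) (by simpa using hB)
  have hM : HasMarginals ν' μ := by
    intro B hB
    constructor
    · rw [← measureReal_def, hdecμ B hB]
      refine Finset.sum_congr rfl fun i _ => ?_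
      have : ∀ j, c i j * π.real (B ×ˢ (Set.univ : Set K) ∩ P i ×ˢ P j)
          = ν (P i ×ˢ P j) * (μ.real (B ∩ P i) / μ.real (P i)) := by
        intro j
        rw [Set.prod_inter_prod, Set.univ_inter, measureReal_prod_prod]
        simp only [c]
        by_cases hj : μ.real (P j) = 0
        · simp [hQ2 i j hj]
        by_cases hi : μ.real (P i) = 0
        · simp [hQ1 i j hi]
        field_simp
      rw [Finset.sum_congr rfl fun j _ => this j, ← Finset.sum_mul, hsum1]
      by_cases hi : μ.real (P i) = 0
      · have : μ.real (B ∩ P i) = 0 :=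
          le_antisymm (hi ▸ measureReal_mono Set.inter_subset_right) measureReal_nonneg
        simp [this]
      · field_simp
    · rw [← measureReal_def, hdecμ B hB]
      simp only [ν']
      rw [Finset.sum_comm]
      refine Finset.sum_congr rfl fun j _ => ?_
      have : ∀ i, c i j * π.real ((Set.univ : Set K) ×ˢ B ∩ P i ×ˢ P j)
          = ν (P i ×ˢ P j) * (μ.real (B ∩ P j) / μ.real (P j)) := by
        intro i
        rw [Set.prod_inter_prod, Set.univ_inter, measureReal_prod_prod]
        simp only [c]
        by_cases hj : μ.real (P j) = 0
        · simp [hQ2 i j hj]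
        by_cases hi : μ.real (P i) = 0
        · simp [hQ1 i j hi]
        field_simp
      rw [Finset.sum_congr rfl fun i _ => this i, ← Finset.sum_mul, hsum2]
      by_cases hi : μ.real (P j) = 0
      · have : μ.real (B ∩ P j) = 0 :=
          le_antisymm (hi ▸ measureReal_mono Set.inter_subset_right) measureReal_nonneg
        simp [this]
      · field_simp
  have hRm : ∀ S ∈ rectAlgebra K, MeasurableSet S := by
    intro S hS
    induction hS with
    | base S h =>
      obtain ⟨A, hA, B, hB, rfl⟩ := h
      exact MeasurableSet.prod hA hB
    | empty => exact MeasurableSet.empty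
    | compl S _ ih => exact ih.compl
    | union S T _ _ ih1 ih2 => exact ih1.union ih2
  refine ⟨ν', ⟨?_, ?_, ?_⟩, hM, ?_⟩
  · intro S _
    refine Finset.sum_nonneg fun i _ => Finset.sum_nonneg fun j _ => ?_
    exact mul_nonneg (div_nonneg (hQ0 i j) (mul_nonneg measureReal_nonneg measureReal_nonneg))
      measureReal_nonneg
  · have := (hM Set.univ MeasurableSet.univ).1
    rw [Set.univ_prod_univ] at this
    simpa using this
  · intro S _ T hT hd
    simp only [ν', ← Finset.sum_add_distrib]
    refine Finset.sum_congr rfl fun i _ => Finset.sum_congr rfl fun j _ => ?_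
    rw [Set.union_inter_distrib_right, measureReal_union
      (hd.mono Set.inter_subset_left Set.inter_subset_left)
      ((hRm T hT).inter ((hPm i).prod (hPm j))), mul_add]
  · intro S hS
    have hdec := finAdd_decomp hP hν (fun p : K × K => (f p.1, f p.2)) (fun q => by
      convert hrect _ (hPA q.1) _ (hPA q.2) using 1
      ext x
      simp [P, Prod.ext_iff]) hS
    rw [hdec, Fintype.sum_prod_type]
    refine Finset.sum_congr rfl fun i _ => Finset.sum_congr rfl fun j _ => ?_
    have e : (fun p : K × K => (f p.1, f p.2)) ⁻¹' {(i, j)} = P i ×ˢ P j := by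
      ext x
      simp [P]
    rw [e]
    by_cases hne : (S ∩ P i ×ˢ P j).Nonempty
    · obtain ⟨x, hxS, hx⟩ := hne
      have : S ∩ P i ×ˢ P j = P i ×ˢ P j :=
        Set.inter_eq_right.2 fun y hy => (hSdich S hS i j x hx y hy).1 hxS
      rw [this, measureReal_prod_prod]
      simp only [c]
      by_cases hj : μ.real (P j) = 0
      · simp [hQ2 i j hj]
      by_cases hi : μ.real (P i) = 0
      · simp [hQ1 i j hi]
      field_simp
    · rw [Set.not_nonempty_iff_eq_empty] at hne
      simp [hne, hν0]
end
end

section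
/- Let K be a compact Hausdorff space, μ a Radon probability measure on K, 𝒜 a finite subalgebra of Bor(K), and B ∈ Bor(K) a set with μ(B) = 1/2 which is μ-independent of 𝒜 (i.e. μ(B ∩ A) = (1/2)·μ(A) for every A ∈ 𝒜). Let 𝒜₁ be the algebra generated by 𝒜 ∪ {B}. Then every finitely additive probability measure ν on 𝒜 ⊗ 𝒜 with marginals μ has an extension to a finitely additive probability measure ν₁ on 𝒜₁ ⊗ 𝒜₁ with marginals μ such that ν₁(B×B) = 1/2. -/
open MeasureTheory Set

noncomputable section

/-- A finite union of members of a set algebra is a member. -/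
theorem aux_sUnion {α : Type*} {S : Set (Set α)} (hS : IsSetAlgebra S) (F : Set (Set α))
    (hF : F.Finite) (h : ∀ A ∈ F, A ∈ S) : ⋃₀ F ∈ S := by
  induction F, hF using Set.Finite.induction_on with
  | empty => simpa using hS.empty_mem
  | insert _ _ ih =>
    rw [sUnion_insert]
    exact hS.union_mem (h _ (mem_insert _ _)) (ih fun A hA => h A (mem_insert_of_mem _ hA))

/-- A finite intersection of members of a set algebra is a member. -/
theorem aux_sInter {α : Type*} {S : Set (Set α)} (hS : IsSetAlgebra S) (F : Set (Set α))
    (hF : F.Finite) (h : ∀ A ∈ F, A ∈ S) : ⋂₀ F ∈ S := by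
  induction F, hF using Set.Finite.induction_on with
  | empty => simpa using hS.univ_mem
  | insert _ _ ih =>
    rw [sInter_insert]
    exact hS.inter_mem (h _ (mem_insert _ _)) (ih fun A hA => h A (mem_insert_of_mem _ hA))

/-- The atom of `x` in `𝒜`. -/
def atomOf {K : Type*} (𝒜 : Set (Set K)) (x : K) : Set K := ⋂₀ {A ∈ 𝒜 | x ∈ A}

theorem mem_atomOf {K : Type*} (𝒜 : Set (Set K)) (x : K) : x ∈ atomOf 𝒜 x :=
  fun _ hA => hA.2

theorem atomOf_mem {K : Type*} {𝒜 : Set (Set K)} (h : IsSetAlgebra 𝒜) (hf : 𝒜.Finite) (x : K) :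
    atomOf 𝒜 x ∈ 𝒜 :=
  aux_sInter h _ (hf.subset (sep_subset _ _)) fun _ hA => hA.1

theorem mem_iff_of_atom {K : Type*} {𝒜 : Set (Set K)} (h : IsSetAlgebra 𝒜) {x y : K}
    (hy : y ∈ atomOf 𝒜 x) {A : Set K} (hA : A ∈ 𝒜) : y ∈ A ↔ x ∈ A := by
  constructor
  · intro hyA
    by_contra hx
    exact hy Aᶜ ⟨h.compl_mem hA, hx⟩ hyA
  · intro hx
    exact hy A ⟨hA, hx⟩

theorem atomOf_eq {K : Type*} {𝒜 : Set (Set K)} (h : IsSetAlgebra 𝒜) {x y : K}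
    (hy : y ∈ atomOf 𝒜 x) : atomOf 𝒜 y = atomOf 𝒜 x := by
  unfold atomOf
  congr 1
  ext A
  exact and_congr_right fun hA => mem_iff_of_atom h hy hA

/-- A selector hitting `B` on every atom that meets `B`. -/
theorem exists_selector {K : Type*} {𝒜 : Set (Set K)} (h : IsSetAlgebra 𝒜) (B : Set K) :
    ∃ b : K → K, (∀ x, b x ∈ atomOf 𝒜 x) ∧ (∀ x y, y ∈ atomOf 𝒜 x → b y = b x) ∧
      ∀ x ∈ B, b x ∈ B := by
  classical
  have key : ∀ a : range (atomOf 𝒜), ∃ z, z ∈ a.1 ∧ ((a.1 ∩ B).Nonempty → z ∈ B) := by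
    rintro ⟨_, x, rfl⟩
    by_cases hB : (atomOf 𝒜 x ∩ B).Nonempty
    · obtain ⟨z, hz, hzB⟩ := hB
      exact ⟨z, hz, fun _ => hzB⟩
    · exact ⟨x, mem_atomOf _ _, fun h => absurd h hB⟩
  choose z hz hzB using key
  refine ⟨fun x => z ⟨atomOf 𝒜 x, x, rfl⟩, fun x => hz ⟨atomOf 𝒜 x, x, rfl⟩, ?_, ?_⟩
  · intro x y hy
    simp only [atomOf_eq h hy]
  · intro x hx
    exact hzB ⟨atomOf 𝒜 x, x, rfl⟩ ⟨x, mem_atomOf _ _, hx⟩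

theorem preimage_mem_alg {K : Type*} {𝒜 : Set (Set K)} (h : IsSetAlgebra 𝒜) (hf : 𝒜.Finite)
    {b : K → K} (hb : ∀ x y, y ∈ atomOf 𝒜 x → b y = b x) (S : Set K) : b ⁻¹' S ∈ 𝒜 := by
  have : b ⁻¹' S = ⋃₀ (atomOf 𝒜 '' (b ⁻¹' S)) := by
    ext y
    constructor
    · intro hy
      exact ⟨_, ⟨y, hy, rfl⟩, mem_atomOf _ _⟩
    · rintro ⟨_, ⟨x, hx, rfl⟩, hy⟩
      simpa [hb x y hy] using hx
  have hsub : ∀ A ∈ atomOf 𝒜 '' (b ⁻¹' S), A ∈ 𝒜 := by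
    rintro _ ⟨x, _, rfl⟩
    exact atomOf_mem h hf x
  rw [this]
  exact aux_sUnion h _ (hf.subset hsub) hsub

theorem rect_mem {K : Type*} {𝒜 : Set (Set K)} {A C : Set K} (hA : A ∈ 𝒜) (hC : C ∈ 𝒜) :
    A ×ˢ C ∈ prodAlg 𝒜 𝒜 :=
  self_subset_generateSetAlgebra ⟨A, hA, C, hC, rfl⟩

theorem preimage_mem_prod {K : Type*} {𝒜 : Set (Set K)} (h : IsSetAlgebra 𝒜) (hf : 𝒜.Finite)
    {b : K → K} (hb : ∀ x y, y ∈ atomOf 𝒜 x → b y = b x) (S : Set (K × K)) :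
    Prod.map b b ⁻¹' S ∈ prodAlg 𝒜 𝒜 := by
  have : Prod.map b b ⁻¹' S =
      ⋃₀ ((fun p : K × K => atomOf 𝒜 p.1 ×ˢ atomOf 𝒜 p.2) '' (Prod.map b b ⁻¹' S)) := by
    ext y
    constructor
    · intro hy
      exact ⟨_, ⟨y, hy, rfl⟩, mem_atomOf _ _, mem_atomOf _ _⟩
    · rintro ⟨_, ⟨x, hx, rfl⟩, hy1, hy2⟩
      simpa [Prod.map, hb _ _ hy1, hb _ _ hy2] using hx
  rw [this]
  refine aux_sUnion isSetAlgebra_generateSetAlgebra _ ?_ ?_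
  · refine (Set.Finite.image2 (fun A C : Set K => A ×ˢ C) hf hf).subset ?_
    rintro _ ⟨x, _, rfl⟩
    exact ⟨_, atomOf_mem h hf _, _, atomOf_mem h hf _, rfl⟩
  · rintro _ ⟨x, _, rfl⟩
    exact rect_mem (atomOf_mem h hf _) (atomOf_mem h hf _)

theorem preimage_eq_self {K : Type*} {𝒜 : Set (Set K)} (h : IsSetAlgebra 𝒜)
    {b : K → K} (hb : ∀ x, b x ∈ atomOf 𝒜 x) {S : Set (K × K)} (hS : S ∈ prodAlg 𝒜 𝒜) :
    Prod.map b b ⁻¹' S = S := by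
  unfold prodAlg at hS
  induction hS with
  | base s hs =>
    obtain ⟨A, hA, C, hC, rfl⟩ := hs
    ext ⟨x, y⟩
    simp [mem_iff_of_atom h (hb x) hA, mem_iff_of_atom h (hb y) hC]
  | empty => simp
  | compl s _ ih => rw [preimage_compl, ih]
  | union s t _ _ ih1 ih2 => rw [preimage_union, ih1, ih2]

theorem gen_form {K : Type*} {𝒜 : Set (Set K)} (h : IsSetAlgebra 𝒜) (B : Set K) {A : Set K}
    (hA : A ∈ generateSetAlgebra (insert B 𝒜)) :
    ∃ C ∈ 𝒜, ∃ D ∈ 𝒜, ∀ x, x ∈ A ↔ (x ∈ B ∧ x ∈ C) ∨ (x ∉ B ∧ x ∈ D) := by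
  induction hA with
  | base s hs =>
    rcases hs with rfl | hs
    · exact ⟨univ, h.univ_mem, ∅, h.empty_mem, by simp⟩
    · exact ⟨s, hs, s, hs, fun x => by tauto⟩
  | empty => exact ⟨∅, h.empty_mem, ∅, h.empty_mem, by simp⟩
  | compl s _ ih =>
    obtain ⟨C, hC, D, hD, e⟩ := ih
    refine ⟨Cᶜ, h.compl_mem hC, Dᶜ, h.compl_mem hD, fun x => ?_⟩
    simp only [mem_compl_iff, e]; tauto
  | union s t _ _ ih1 ih2 =>
    obtain ⟨C, hC, D, hD, e⟩ := ih1
    obtain ⟨C', hC', D', hD', e'⟩ := ih2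
    refine ⟨C ∪ C', h.union_mem hC hC', D ∪ D', h.union_mem hD hD', fun x => ?_⟩
    simp only [mem_union, e, e']; tauto

/-- Let `𝒜` be a finite subalgebra of `Bor(K)` and `B` a Borel set of measure `1/2` which is
`μ`-independent of `𝒜`, and let `𝒜₁` be the algebra generated by `𝒜 ∪ {B}`. Then every
finitely additive probability measure on `𝒜 ⊗ 𝒜` with marginals `μ` extends to a finitely
additive probability measure on `𝒜₁ ⊗ 𝒜₁` with marginals `μ` giving `B × B` measure `1/2`. -/
theorem stmt11 (K : Type*) [TopologicalSpace K] [CompactSpace K] [T2Space K]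
    (μ : RadonProb K) (𝒜 : Set (Set K)) (h𝒜 : MeasureTheory.IsSetAlgebra 𝒜)
    (h𝒜f : 𝒜.Finite) (h𝒜m : ∀ A ∈ 𝒜, MeasurableSet[borel K] A)
    (B : Set K) (hB : MeasurableSet[borel K] B) (hBhalf : μ.1 B = 1/2)
    (hBindep : ∀ A ∈ 𝒜, μ.1 (B ∩ A) = μ.1 A / 2)
    (𝒜₁ : Set (Set K)) (h𝒜₁ : 𝒜₁ = MeasureTheory.generateSetAlgebra (insert B 𝒜))
    (ν : Set (K × K) → ℝ) (hν : IsFinAddProb (prodAlg 𝒜 𝒜) ν)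
    (hmarg : ∀ A ∈ 𝒜, ν (A ×ˢ (Set.univ : Set K)) = (μ.1 A).toReal ∧
      ν ((Set.univ : Set K) ×ˢ A) = (μ.1 A).toReal) :
    ∃ ν₁ : Set (K × K) → ℝ, IsFinAddProb (prodAlg 𝒜₁ 𝒜₁) ν₁ ∧
      (∀ A ∈ 𝒜₁, ν₁ (A ×ˢ (Set.univ : Set K)) = (μ.1 A).toReal ∧
        ν₁ ((Set.univ : Set K) ×ˢ A) = (μ.1 A).toReal) ∧
      (∀ S ∈ prodAlg 𝒜 𝒜, ν₁ S = ν S) ∧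
      ν₁ (B ×ˢ B) = 1/2 := by
  let _ : MeasurableSpace K := borel K
  have : IsProbabilityMeasure μ.1 := μ.2.1
  obtain ⟨hν0, hνu, hνa⟩ := hν
  obtain ⟨b, hb1, hb2, hb3⟩ := exists_selector h𝒜 B
  obtain ⟨c, hc1, hc2, hc3⟩ := exists_selector h𝒜 Bᶜ
  have hbA := fun S => preimage_mem_alg h𝒜 h𝒜f hb2 S
  have hcA := fun S => preimage_mem_alg h𝒜 h𝒜f hc2 S
  have hbP := fun S => preimage_mem_prod h𝒜 h𝒜f hb2 S
  have hcP := fun S => preimage_mem_prod h𝒜 h𝒜f hc2 S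
  have hBr : ∀ A ∈ 𝒜, (μ.1 (B ∩ A)).toReal = (μ.1 A).toReal / 2 := by
    intro A hA
    rw [hBindep A hA, ENNReal.toReal_div]; rfl
  have hBc : ∀ A ∈ 𝒜, (μ.1 (A \ B)).toReal = (μ.1 A).toReal / 2 := by
    intro A hA
    have h1 := measureReal_inter_add_sdiff (μ := μ.1) (s := A) hB
    have h2 := hBr A hA
    rw [inter_comm] at h2
    simp only [Measure.real] at h1
    linarith
  have hN : (μ.1 (b ⁻¹' Bᶜ)).toReal = 0 := by
    have h1 := hBr _ (hbA Bᶜ)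
    have h2 : B ∩ b ⁻¹' Bᶜ = ∅ := by
      ext x
      simp only [mem_inter_iff, mem_preimage, mem_compl_iff, mem_empty_iff_false, iff_false]
      exact fun h => h.2 (hb3 x h.1)
    rw [h2] at h1
    rw [measure_empty, ENNReal.toReal_zero] at h1
    linarith
  have hM : (μ.1 (c ⁻¹' B)).toReal = 0 := by
    have h1 := hBc _ (hcA B)
    have h2 : c ⁻¹' B \ B = ∅ := by
      ext x
      simp only [mem_sdiff, mem_preimage, mem_empty_iff_false, iff_false]
      exact fun h => hc3 x h.2 h.1
    rw [h2] at h1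
    rw [measure_empty, ENNReal.toReal_zero] at h1
    linarith
  have hbC : ∀ A ∈ 𝒜, b ⁻¹' A = A := fun A hA => by
    ext x; exact mem_iff_of_atom h𝒜 (hb1 x) hA
  have hcC : ∀ A ∈ 𝒜, c ⁻¹' A = A := fun A hA => by
    ext x; exact mem_iff_of_atom h𝒜 (hc1 x) hA
  have hN' : μ.1 (b ⁻¹' Bᶜ) = 0 := by
    rcases (ENNReal.toReal_eq_zero_iff _).1 hN with h | h
    · exact h
    · exact absurd h (measure_ne_top _ _)
  have hM' : μ.1 (c ⁻¹' B) = 0 := by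
    rcases (ENNReal.toReal_eq_zero_iff _).1 hM with h | h
    · exact h
    · exact absurd h (measure_ne_top _ _)
  have hmain : ∀ A ∈ 𝒜₁, ((μ.1 (b ⁻¹' A)).toReal + (μ.1 (c ⁻¹' A)).toReal) / 2
      = (μ.1 A).toReal := by
    intro A hA
    rw [h𝒜₁] at hA
    obtain ⟨C, hC, D, hD, e⟩ := gen_form h𝒜 B hA
    have e1 : μ.1 (b ⁻¹' A) = μ.1 C := by
      apply measure_congr
      have : ∀ᵐ x ∂μ.1, x ∉ b ⁻¹' Bᶜ := measure_eq_zero_iff_ae_notMem.1 hN'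
      filter_upwards [this] with x hx
      have h3 : b x ∈ B := by simpa using hx
      have h4 : b x ∈ C ↔ x ∈ C := mem_iff_of_atom h𝒜 (hb1 x) hC
      apply propext
      change b x ∈ A ↔ x ∈ C
      rw [e]; tauto
    have e2 : μ.1 (c ⁻¹' A) = μ.1 D := by
      apply measure_congr
      have : ∀ᵐ x ∂μ.1, x ∉ c ⁻¹' B := measure_eq_zero_iff_ae_notMem.1 hM'
      filter_upwards [this] with x hx
      have h3 : c x ∉ B := by simpa using hx
      have h4 : c x ∈ D ↔ x ∈ D := mem_iff_of_atom h𝒜 (hc1 x) hD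
      apply propext
      change c x ∈ A ↔ x ∈ D
      rw [e]; tauto
    have h1 := measureReal_inter_add_sdiff (μ := μ.1) (s := A) hB
    have e3 : A ∩ B = B ∩ C := by
      ext x; simp only [mem_inter_iff, e]; tauto
    have e4 : A \ B = D \ B := by
      ext x; simp only [mem_sdiff, e]; tauto
    simp only [Measure.real, e3, e4, hBr C hC, hBc D hD] at h1
    rw [e1, e2]; linarith
  refine ⟨fun S => (ν (Prod.map b b ⁻¹' S) + ν (Prod.map c c ⁻¹' S)) / 2,
    ⟨?_, ?_, ?_⟩, ?_, ?_, ?_⟩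
  · intro S _
    have h1 := hν0 _ (hbP S)
    have h2 := hν0 _ (hcP S)
    show 0 ≤ (ν (Prod.map b b ⁻¹' S) + ν (Prod.map c c ⁻¹' S)) / 2
    linarith
  · simp only [preimage_univ, hνu]; norm_num
  · intro S _ T _ hST
    have h1 := hνa _ (hbP S) _ (hbP T) (hST.preimage _)
    have h2 := hνa _ (hcP S) _ (hcP T) (hST.preimage _)
    simp only [preimage_union, h1, h2]; ring
  · intro A hA
    have h1 := hmarg _ (hbA A)
    have h2 := hmarg _ (hcA A)
    rw [← hmain A hA, ← h1.1, ← h2.1]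
    refine ⟨rfl, ?_⟩
    rw [h1.1, h2.1, ← h1.2, ← h2.2]
    rfl
  · intro S hS
    simp only [preimage_eq_self h𝒜 hb1 hS, preimage_eq_self h𝒜 hc1 hS]; ring
  · have hPr : ∀ b : K → K, Prod.map b b ⁻¹' (B ×ˢ B) = (b ⁻¹' B) ×ˢ (b ⁻¹' B) := fun _ => rfl
    simp only [hPr]
    have hu := h𝒜.univ_mem
    -- the `c` part vanishes
    have c1 := hνa _ (rect_mem (hcA B) (hcA B)) _ (rect_mem (hcA B) (hcA Bᶜ))
      (by rw [disjoint_left]; rintro ⟨x, y⟩ h1 h2; exact h2.2 h1.2)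
    have c2 : (c ⁻¹' B) ×ˢ (c ⁻¹' B) ∪ (c ⁻¹' B) ×ˢ (c ⁻¹' Bᶜ) = (c ⁻¹' B) ×ˢ (univ : Set K) := by
      rw [← prod_union, ← preimage_union]; simp
    rw [c2, (hmarg _ (hcA B)).1, hM] at c1
    have c3 := hν0 _ (rect_mem (hcA B) (hcA B))
    have c4 := hν0 _ (rect_mem (hcA B) (hcA Bᶜ))
    -- the `b` part is everything
    have b1 := hνa _ (rect_mem (hbA B) (hbA B)) _ (rect_mem (hbA B) (hbA Bᶜ))
      (by rw [disjoint_left]; rintro ⟨x, y⟩ h1 h2; exact h2.2 h1.2)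
    have b2 : (b ⁻¹' B) ×ˢ (b ⁻¹' B) ∪ (b ⁻¹' B) ×ˢ (b ⁻¹' Bᶜ) = (b ⁻¹' B) ×ˢ (univ : Set K) := by
      rw [← prod_union, ← preimage_union]; simp
    have b3 := hνa _ (rect_mem (hbA B) hu) _ (rect_mem (hbA Bᶜ) hu)
      (by rw [disjoint_left]; rintro ⟨x, y⟩ h1 h2; exact h2.1 h1.1)
    have b4 : (b ⁻¹' B) ×ˢ (univ : Set K) ∪ (b ⁻¹' Bᶜ) ×ˢ (univ : Set K) = univ := by
      rw [← union_prod, ← preimage_union]; simp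
    have b5 := hνa _ (rect_mem (hbA B) (hbA Bᶜ)) _ (rect_mem (hbA Bᶜ) (hbA Bᶜ))
      (by rw [disjoint_left]; rintro ⟨x, y⟩ h1 h2; exact h2.1 h1.1)
    have b6 : (b ⁻¹' B) ×ˢ (b ⁻¹' Bᶜ) ∪ (b ⁻¹' Bᶜ) ×ˢ (b ⁻¹' Bᶜ)
        = (univ : Set K) ×ˢ (b ⁻¹' Bᶜ) := by
      rw [← union_prod, ← preimage_union]; simp
    rw [b2] at b1
    rw [b4, hνu, (hmarg _ (hbA Bᶜ)).1, hN] at b3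
    rw [b6, (hmarg _ (hbA Bᶜ)).2, hN] at b5
    have b7 := hν0 _ (rect_mem (hbA B) (hbA Bᶜ))
    have b8 := hν0 _ (rect_mem (hbA Bᶜ) (hbA Bᶜ))
    linarith
end
end

section
/- Let K be a compact Hausdorff space, μ ∈ P(K) a homogeneous Radon probability measure of Maharam type ω₁, and suppose ⟨B_ξ : ξ < ω₁⟩ (Borel sets) and ⟨U_ξ : ξ < ω₁⟩ (open sets) satisfy: μ(B_ξ) = 1/2; B_ξ ⊆ U_ξ; and μ(B_ξ ∩ C) = (1/2)·μ(C) for every C in the algebra generated by 𝒞_ξ = {B_η : η < ξ} ∪ {U_η : η < ξ}. Then for every ξ < ω₁ there is a finitely additive probability measure ν_ξ on the rectangle algebra 𝓡 = Bor(K) ⊗ Bor(K) with marginals μ such that ν_ξ(B_η × B_η) = 1/2 for every η ≥ ξ, and ν_ξ(A × A) = μ(A)² for every A ∈ 𝒞_ξ. -/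
open MeasureTheory Set

noncomputable section

open Filter Topology in
theorem stmt12_core {K I : Type*} [MeasurableSpace K] (μ : Measure K) [IsProbabilityMeasure μ]
    (B : I → Set K) (hB : ∀ i, MeasurableSet (B i)) (C : Set (Set K))
    (hC : ∀ A ∈ C, MeasurableSet A)
    (huniv : ∀ (F : Finset I) (x : K),
      μ (univ ∩ {y | ∀ i ∈ F, x ∈ B i ↔ y ∈ B i}) = μ univ / 2 ^ F.card)
    (h : ∀ A ∈ C, ∀ (F : Finset I) (x : K),
      μ (A ∩ {y | ∀ i ∈ F, x ∈ B i ↔ y ∈ B i}) = μ A / 2 ^ F.card) :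
    ∃ ν : Set (K × K) → ℝ, (∀ S, 0 ≤ ν S) ∧ ν univ = 1 ∧
      (∀ S T, MeasurableSet S → MeasurableSet T → Disjoint S T → ν (S ∪ T) = ν S + ν T) ∧
      (∀ E, MeasurableSet E → ν (E ×ˢ univ) = (μ E).toReal ∧ ν (univ ×ˢ E) = (μ E).toReal) ∧
      (∀ i, ν (B i ×ˢ B i) = (μ (B i)).toReal) ∧
      (∀ A ∈ C, ν (A ×ˢ A) = (μ A).toReal ^ 2) := by
  classical
  let D : Finset I → Set (K × K) := fun F => {p | ∀ i ∈ F, p.1 ∈ B i ↔ p.2 ∈ B i}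
  have hD : ∀ F, MeasurableSet (D F) := by
    intro F
    have : D F = ⋂ i ∈ F, ((B i ×ˢ B i) ∪ ((B i)ᶜ ×ˢ (B i)ᶜ)) := by
      ext p
      simp only [D, mem_setOf_eq, mem_iInter, mem_union, mem_prod, mem_compl_iff]
      refine forall₂_congr fun i _ => ?_
      tauto
    rw [this]
    exact Finset.measurableSet_biInter _ fun i _ =>
      ((hB i).prod (hB i)).union ((hB i).compl.prod (hB i).compl)
  -- product formula
  have key : ∀ (F : Finset I) (E A : Set K), MeasurableSet E → MeasurableSet A →
      (∀ x, μ (A ∩ {y | ∀ i ∈ F, x ∈ B i ↔ y ∈ B i}) = μ A / 2 ^ F.card) →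
      (μ.prod μ) ((E ×ˢ A) ∩ D F) = μ A / 2 ^ F.card * μ E := by
    intro F E A hE hA hx
    rw [Measure.prod_apply ((hE.prod hA).inter (hD F))]
    have : (fun x => μ (Prod.mk x ⁻¹' ((E ×ˢ A) ∩ D F)))
        = E.indicator (fun _ => μ A / 2 ^ F.card) := by
      ext x
      by_cases hxE : x ∈ E
      · rw [indicator_of_mem hxE, ← hx x]
        congr 1
        ext y
        simp [D, hxE]
      · rw [indicator_of_notMem hxE]
        convert measure_empty (μ := μ)
        ext y
        simp [hxE]
    rw [this, lintegral_indicator hE]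
    simp
  have key' : ∀ (F : Finset I) (E : Set K), MeasurableSet E →
      (μ.prod μ) ((univ ×ˢ E) ∩ D F) = (μ.prod μ) ((E ×ˢ univ) ∩ D F) := by
    intro F E hE
    have hm := (((MeasurableSet.univ (α := K)).prod hE).inter (hD F))
    rw [← Measure.prod_swap (μ := μ) (ν := μ), Measure.map_apply measurable_swap hm,
      Measure.prod_swap]
    congr 1
    ext p
    simp [D, iff_comm]
  let m : Finset I → Set (K × K) → ℝ := fun F S =>
    (2 ^ F.card * (μ.prod μ) (S ∩ D F)).toReal
  have h2 : ∀ n : ℕ, (2 : ENNReal) ^ n ≠ 0 := fun n => by positivity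
  have h2' : ∀ n : ℕ, (2 : ENNReal) ^ n ≠ ⊤ := fun n => by finiteness
  have cancel : ∀ (n : ℕ) (a b : ENNReal), 2 ^ n * (a / 2 ^ n * b) = a * b := by
    intro n a b
    rw [← mul_assoc, ENNReal.mul_div_cancel (h2 n) (h2' n)]
  have mleft : ∀ F E, MeasurableSet E → m F (E ×ˢ univ) = (μ E).toReal := by
    intro F E hE
    simp only [m]
    rw [key F E univ hE .univ (huniv F), cancel, measure_univ, one_mul]
  have mright : ∀ F E, MeasurableSet E → m F (univ ×ˢ E) = (μ E).toReal := by
    intro F E hE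
    rw [← mleft F E hE]
    simp only [m]
    rw [key' F E hE]
  have mB : ∀ F, ∀ i ∈ F, m F (B i ×ˢ B i) = (μ (B i)).toReal := by
    intro F i hi
    rw [← mleft F _ (hB i)]
    simp only [m]
    congr 3
    ext p
    simp only [D, mem_inter_iff, mem_prod, mem_univ, and_true, mem_setOf_eq]
    constructor
    · rintro ⟨⟨a, b⟩, c⟩
      exact ⟨a, c⟩
    · rintro ⟨a, c⟩
      exact ⟨⟨a, (c i hi).1 a⟩, c⟩
  have mC : ∀ F, ∀ A ∈ C, m F (A ×ˢ A) = (μ A).toReal ^ 2 := by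
    intro F A hA
    simp only [m]
    rw [key F A A (hC A hA) (hC A hA) (h A hA F), cancel, ENNReal.toReal_mul, sq]
  have muniv : ∀ F, m F univ = 1 := by
    intro F
    have := mleft F univ .univ
    rwa [univ_prod_univ, measure_univ, ENNReal.toReal_one] at this
  have m0 : ∀ F S, 0 ≤ m F S := fun F S => ENNReal.toReal_nonneg
  have m1 : ∀ F S, m F S ≤ 1 := by
    intro F S
    rw [← muniv F]
    simp only [m]
    refine ENNReal.toReal_mono (ENNReal.mul_ne_top (h2' _) (measure_ne_top _ _)) ?_
    gcongr
    exact subset_univ S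
  have madd : ∀ F S T, MeasurableSet S → MeasurableSet T → Disjoint S T →
      m F (S ∪ T) = m F S + m F T := by
    intro F S T hS hT hST
    simp only [m]
    rw [union_inter_distrib_right, measure_union (hST.mono inter_subset_left inter_subset_left)
      (hT.inter (hD F)), mul_add, ENNReal.toReal_add]
    · exact ENNReal.mul_ne_top (h2' _) (measure_ne_top _ _)
    · exact ENNReal.mul_ne_top (h2' _) (measure_ne_top _ _)
  let u : Ultrafilter (Finset I) := Ultrafilter.of atTop
  have hu : (u : Filter (Finset I)) ≤ atTop := Ultrafilter.of_le _
  have hex : ∀ S, ∃ l : ℝ, Tendsto (fun F => m F S) u (𝓝 l) := by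
    intro S
    have hc := (isCompact_Icc (a := (0 : ℝ)) (b := 1)).ultrafilter_le_nhds
      (u.map (fun F => m F S)) (by
        rw [le_principal_iff]
        exact mem_map.2 (univ_mem' fun F => ⟨m0 F S, m1 F S⟩))
    obtain ⟨l, -, hl⟩ := hc
    exact ⟨l, hl⟩
  choose ν hν using hex
  have hconst : ∀ S (c : ℝ), (∀ᶠ F in atTop, m F S = c) → ν S = c := by
    intro S c hc
    refine tendsto_nhds_unique (hν S) ?_
    exact tendsto_const_nhds.congr' ((hc.filter_mono hu).mono fun F hF => hF.symm)
  refine ⟨ν, fun S => ge_of_tendsto' (hν S) fun F => m0 F S,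
    hconst _ _ (.of_forall muniv), ?_, ?_, ?_, ?_⟩
  · intro S T hS hT hST
    refine tendsto_nhds_unique (hν _) ?_
    exact ((hν S).add (hν T)).congr fun F => (madd F S T hS hT hST).symm
  · exact fun E hE => ⟨hconst _ _ (.of_forall fun F => mleft F E hE),
      hconst _ _ (.of_forall fun F => mright F E hE)⟩
  · intro i
    refine hconst _ _ ((eventually_ge_atTop {i}).mono fun F hF => mB F i ?_)
    exact hF (Finset.mem_singleton_self i)
  · exact fun A hA => hconst _ _ (.of_forall fun F => mC F A hA)

/-- Given `μ` homogeneous of type `ω₁` and sequences `⟨B_ξ⟩`, `⟨U_ξ⟩` as in the independence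
lemma, for every `ξ < ω₁` there is a finitely additive probability measure `ν_ξ` on
`𝓡 = Bor(K) ⊗ Bor(K)` with marginals `μ` such that `ν_ξ(B_η × B_η) = 1/2` for `η ≥ ξ`
and `ν_ξ(A × A) = μ(A)²` for every `A ∈ 𝒞_ξ`. -/
theorem stmt12 (K : Type*) [TopologicalSpace K] [CompactSpace K] [T2Space K]
    (μ : RadonProb K) (hμ : IsHomogeneousOmega1 μ.1)
    (B U : Ordinal → Set K)
    (hBm : ∀ ξ < (Cardinal.aleph 1).ord, MeasurableSet[borel K] (B ξ))
    (hUo : ∀ ξ < (Cardinal.aleph 1).ord, IsOpen (U ξ))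
    (hBhalf : ∀ ξ < (Cardinal.aleph 1).ord, μ.1 (B ξ) = 1/2)
    (hBU : ∀ ξ < (Cardinal.aleph 1).ord, B ξ ⊆ U ξ)
    (hindep : ∀ ξ < (Cardinal.aleph 1).ord, ∀ C ∈ MeasureTheory.generateSetAlgebra
        ({S | ∃ η < ξ, S = B η} ∪ {S | ∃ η < ξ, S = U η} : Set (Set K)),
      μ.1 (B ξ ∩ C) = μ.1 C / 2) :
    ∀ ξ < (Cardinal.aleph 1).ord, ∃ ν : Set (K × K) → ℝ,
      IsFinAddProb (rectAlgebra K) ν ∧ HasMarginals ν μ.1 ∧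
      (∀ η, ξ ≤ η → η < (Cardinal.aleph 1).ord → ν (B η ×ˢ B η) = 1/2) ∧
      (∀ A ∈ ({S | ∃ η < ξ, S = B η} ∪ {S | ∃ η < ξ, S = U η} : Set (Set K)),
        ν (A ×ˢ A) = (μ.1 A).toReal ^ 2) := by
  intro ξ hξ
  letI : MeasurableSpace K := borel K
  haveI : BorelSpace K := ⟨rfl⟩
  haveI : IsProbabilityMeasure μ.1 := μ.2.1
  let G : Ordinal → Set (Set K) := fun ξ => {S | ∃ η < ξ, S = B η} ∪ {S | ∃ η < ξ, S = U η}
  let I := {η : Ordinal // ξ ≤ η ∧ η < (Cardinal.aleph 1).ord}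
  have hGm : ∀ A ∈ G ξ, MeasurableSet A := by
    rintro A (⟨η, hη, rfl⟩ | ⟨η, hη, rfl⟩)
    · exact hBm η (hη.trans hξ)
    · exact (hUo η (hη.trans hξ)).measurableSet
  have hGmono : ∀ {a b : Ordinal}, a ≤ b → G a ⊆ G b := by
    rintro a b hab A (⟨η, hη, rfl⟩ | ⟨η, hη, rfl⟩)
    · exact Or.inl ⟨η, hη.trans_le hab, rfl⟩
    · exact Or.inr ⟨η, hη.trans_le hab, rfl⟩
  have main : ∀ A ∈ generateSetAlgebra (G ξ), ∀ (F : Finset I) (x : K),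
      μ.1 (A ∩ {y | ∀ i ∈ F, x ∈ B i.1 ↔ y ∈ B i.1}) = μ.1 A / 2 ^ F.card := by
    intro A hA F x
    have hmem : ∀ (F : Finset I) (b : Ordinal), ξ ≤ b → (∀ i ∈ F, i.1 < b) →
        A ∩ {y | ∀ i ∈ F, x ∈ B i.1 ↔ y ∈ B i.1} ∈ generateSetAlgebra (G b) := by
      intro F b hb
      have alg := isSetAlgebra_generateSetAlgebra (𝒜 := G b)
      induction F using Finset.induction_on with
      | empty =>
        intro _
        simpa using generateSetAlgebra_mono (hGmono hb) hA
      | insert a s has ih =>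
        intro hF
        have h1 := ih fun i hi => hF i (Finset.mem_insert_of_mem hi)
        have h2 : B a.1 ∈ generateSetAlgebra (G b) :=
          self_subset_generateSetAlgebra (Or.inl ⟨a.1, hF a (Finset.mem_insert_self _ _), rfl⟩)
        by_cases hx : x ∈ B a.1
        · convert alg.inter_mem h1 h2 using 1
          ext y
          simp [hx]
          tauto
        · convert alg.inter_mem h1 (alg.compl_mem h2) using 1
          ext y
          simp [hx]
          tauto
    induction F using Finset.induction_on_max with
    | empty => simp
    | insert a s has ih =>
      have hmem' := hmem s a.1 a.2.1 (fun i hi => has i hi)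
      have hhalf := hindep a.1 a.2.2 _ hmem'
      have hna : a ∉ s := fun h => lt_irrefl _ (has a h)
      rw [ih] at hhalf
      rw [Finset.card_insert_of_notMem hna, pow_succ]
      have e2 : μ.1 A / 2 ^ s.card / 2 = μ.1 A / (2 ^ s.card * 2) := by
        rw [div_eq_mul_inv, div_eq_mul_inv, div_eq_mul_inv, mul_assoc,
          ENNReal.mul_inv (Or.inr (by simp)) (Or.inr (by simp))]
      by_cases hx : x ∈ B a.1
      · rw [← e2, ← hhalf]
        congr 1
        ext y
        simp [hx]
        tauto
      · have hd := measure_inter_add_diff (μ := μ.1)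
          (A ∩ {y | ∀ i ∈ s, x ∈ B i.1 ↔ y ∈ B i.1}) (hBm a.1 a.2.2)
        rw [inter_comm, hhalf, ih] at hd
        have hne : μ.1 A / 2 ^ s.card / 2 ≠ ⊤ := by
          rw [← hhalf]; exact measure_ne_top _ _
        rw [← e2]
        conv_rhs at hd => rw [← ENNReal.add_halves (μ.1 A / 2 ^ s.card)]
        rw [← (ENNReal.add_right_inj hne).1 hd]
        congr 1
        ext y
        simp [hx]
        tauto
  obtain ⟨ν, h0, h1, hadd, hmarg, hBν, hCν⟩ := stmt12_core μ.1 (fun i : I => B i.1)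
    (fun i => hBm i.1 i.2.2) (G ξ) hGm
    (main univ isSetAlgebra_generateSetAlgebra.univ_mem)
    (fun A hA => main A (self_subset_generateSetAlgebra hA))
  have hmeas : ∀ S ∈ rectAlgebra K, MeasurableSet S := by
    intro S hS
    induction hS with
    | base S hS =>
      obtain ⟨A, hA, A', hA', rfl⟩ := hS
      exact MeasurableSet.prod hA hA'
    | empty => exact .empty
    | compl S _ ih => exact ih.compl
    | union S T _ _ ih1 ih2 => exact ih1.union ih2
  refine ⟨ν, ⟨fun S _ => h0 S, h1, fun S hS T hT => hadd S T (hmeas S hS) (hmeas T hT)⟩,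
    hmarg, ?_, hCν⟩
  intro η h1 h2
  rw [hBν ⟨η, h1, h2⟩, hBhalf η h2]
  simp
end
end

section
/- Let K be a compact Hausdorff space. If every Radon probability measure μ ∈ P(K) has countable Maharam type, then every Radon probability measure ν ∈ P(K×K) has countable Maharam type. -/
open MeasureTheory Set

noncomputable section

theorem countableType_aux {Z K : Type*} [TopologicalSpace Z] [CompactSpace Z] [T2Space Z]
    [MeasurableSpace Z] [BorelSpace Z] [TopologicalSpace K] [MeasurableSpace K] [BorelSpace K]
    (ν : Measure Z) [IsProbabilityMeasure ν] [ν.InnerRegular]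
    (p q : Z → K) (hp : Continuous p) (hq : Continuous q)
    (hb : ∀ U : Set Z, IsOpen U → ∀ z ∈ U, ∃ V W : Set K, IsOpen V ∧ IsOpen W ∧
      z ∈ p ⁻¹' V ∩ q ⁻¹' W ∧ p ⁻¹' V ∩ q ⁻¹' W ⊆ U)
    (h1 : HasCountableType (ν.map p)) (h2 : HasCountableType (ν.map q)) :
    HasCountableType ν := by
  obtain ⟨C1, c1, m1, a1⟩ := h1
  obtain ⟨C2, c2, m2, a2⟩ := h2
  have := c1.to_subtype
  have := c2.to_subtype
  let f : Finset (C1 × C2) → Set Z := fun s => ⋃ x ∈ s, p ⁻¹' x.1.1 ∩ q ⁻¹' x.2.1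
  have hpm := hp.measurable
  have hqm := hq.measurable
  let App : Set Z → Prop := fun B => ∀ ε : ENNReal, 0 < ε → ∃ s, ν (symmDiff B (f s)) < ε
  have happ_union : ∀ A B, App A → App B → App (A ∪ B) := by
    classical
    intro A B hA hB ε hε
    obtain ⟨s, hs⟩ := hA (ε / 2) (ENNReal.half_pos hε.ne')
    obtain ⟨t, ht⟩ := hB (ε / 2) (ENNReal.half_pos hε.ne')
    refine ⟨s ∪ t, ?_⟩
    have hf : f (s ∪ t) = f s ∪ f t := by
      simp only [f]; exact Finset.set_biUnion_union _ _ _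
    have hsub : symmDiff (A ∪ B) (f (s ∪ t)) ⊆ symmDiff A (f s) ∪ symmDiff B (f t) := by
      rw [hf]; intro x; simp only [Set.mem_symmDiff, Set.mem_union]; tauto
    calc _ ≤ ν (symmDiff A (f s) ∪ symmDiff B (f t)) := measure_mono hsub
      _ ≤ _ := measure_union_le _ _
      _ < ε / 2 + ε / 2 := ENNReal.add_lt_add hs ht
      _ = ε := ENNReal.add_halves ε
  have happ_rect : ∀ V W : Set K, IsOpen V → IsOpen W → App (p ⁻¹' V ∩ q ⁻¹' W) := by
    intro V W hV hW ε hε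
    obtain ⟨C, hC, hC'⟩ := a1 V hV.measurableSet (ε / 2) (ENNReal.half_pos hε.ne')
    obtain ⟨D, hD, hD'⟩ := a2 W hW.measurableSet (ε / 2) (ENNReal.half_pos hε.ne')
    rw [Measure.map_apply hpm (hV.measurableSet.symmDiff (m1 C hC))] at hC'
    rw [Measure.map_apply hqm (hW.measurableSet.symmDiff (m2 D hD))] at hD'
    refine ⟨{(⟨C, hC⟩, ⟨D, hD⟩)}, ?_⟩
    have hsub : symmDiff (p ⁻¹' V ∩ q ⁻¹' W) (f {(⟨C, hC⟩, ⟨D, hD⟩)}) ⊆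
        p ⁻¹' (symmDiff V C) ∪ q ⁻¹' (symmDiff W D) := by
      intro x
      simp only [f, Finset.mem_singleton, Set.iUnion_iUnion_eq_left, Set.mem_symmDiff,
        Set.mem_union, Set.mem_inter_iff, Set.mem_preimage]
      tauto
    calc _ ≤ ν (p ⁻¹' (symmDiff V C) ∪ q ⁻¹' (symmDiff W D)) := measure_mono hsub
      _ ≤ _ := measure_union_le _ _
      _ < ε / 2 + ε / 2 := ENNReal.add_lt_add hC' hD'
      _ = ε := ENNReal.add_halves ε
  refine ⟨Set.range f, Set.countable_range f, ?_, ?_⟩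
  · rintro _ ⟨s, rfl⟩
    exact Finset.measurableSet_biUnion s fun x _ =>
      (hpm (m1 _ x.1.2)).inter (hqm (m2 _ x.2.2))
  intro B hB ε hε
  rw [Set.exists_range_iff]
  have h3 : ε / 3 ≠ 0 := (ENNReal.div_pos hε.ne' (by simp)).ne'
  obtain ⟨F, hFB, hF, hFε⟩ := hB.exists_isCompact_diff_lt (measure_ne_top ν B) h3
  obtain ⟨U, hFU, hU, -, hUε⟩ :=
    hF.measurableSet.exists_isOpen_diff_lt (measure_ne_top ν F) h3
  obtain ⟨L, hL, hFL, hLU⟩ : ∃ L, App L ∧ F ⊆ L ∧ L ⊆ U := by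
    refine hF.induction_on (p := fun s => ∃ L, App L ∧ s ⊆ L ∧ L ⊆ U) ?_ ?_ ?_ ?_
    · exact ⟨∅, fun ε hε => ⟨∅, by simpa [f] using hε⟩, subset_rfl, empty_subset _⟩
    · rintro s t hst ⟨L, hL, h1, h2⟩
      exact ⟨L, hL, hst.trans h1, h2⟩
    · rintro s t ⟨L, hL, h1, h2⟩ ⟨M, hM, h3, h4⟩
      exact ⟨L ∪ M, happ_union _ _ hL hM, union_subset_union h1 h3, union_subset h2 h4⟩
    · intro z hz
      obtain ⟨V, W, hV, hW, hz', hs⟩ := hb U hU z (hFU hz)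
      exact ⟨_, mem_nhdsWithin_of_mem_nhds
        (((hV.preimage hp).inter (hW.preimage hq)).mem_nhds hz'),
        _, happ_rect V W hV hW, subset_rfl, hs⟩
  obtain ⟨s, hs⟩ := hL (ε / 3) (pos_iff_ne_zero.2 h3)
  refine ⟨s, ?_⟩
  have hsub : symmDiff B (f s) ⊆ ((B \ F) ∪ (U \ F)) ∪ symmDiff L (f s) := by
    intro x
    have := @hFB x
    have := @hFL x
    have := @hLU x
    simp only [Set.mem_symmDiff, Set.mem_union, Set.mem_diff]
    tauto
  calc _ ≤ ν (((B \ F) ∪ (U \ F)) ∪ symmDiff L (f s)) := measure_mono hsub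
    _ ≤ (ν (B \ F) + ν (U \ F)) + ν (symmDiff L (f s)) :=
      (measure_union_le _ _).trans (add_le_add_left (measure_union_le _ _) _)
    _ < ε / 3 + ε / 3 + ε / 3 := ENNReal.add_lt_add (ENNReal.add_lt_add hFε hUε) hs
    _ = ε := ENNReal.add_thirds ε

theorem map_radon_aux {Z K : Type*} [TopologicalSpace Z] 
    [TopologicalSpace K] [T2Space K]
    [mZ : MeasurableSpace Z] [BorelSpace Z] 
    (ν : Measure Z) [IsProbabilityMeasure ν] [ν.InnerRegular]
    (h : ∀ μ : RadonProb K, HasCountableType μ.1)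
    (p : Z → K) (hp : Continuous p) : HasCountableType (@Measure.map _ _ mZ (borel K) p ν) := by
  letI : MeasurableSpace K := borel K
  haveI : BorelSpace K := ⟨rfl⟩
  exact h ⟨ν.map p, Measure.isProbabilityMeasure_map hp.measurable.aemeasurable,
    Measure.InnerRegular.map_of_continuous hp⟩

/-- If every Radon probability measure on `K` has countable Maharam type, then so does every
Radon probability measure on `K × K`. -/
theorem stmt13 (K : Type*) [TopologicalSpace K] [CompactSpace K] [T2Space K]
    (h : ∀ μ : RadonProb K, HasCountableType μ.1) :
    ∀ ν : RadonProb (K × K), HasCountableType ν.1 := by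
  rintro ⟨ν, hν1, hν2⟩
  letI : MeasurableSpace K := borel K
  haveI : BorelSpace K := ⟨rfl⟩
  haveI : @BorelSpace (K × K) _ (borel (K × K)) := @BorelSpace.mk _ _ (borel _) rfl
  refine @countableType_aux (K × K) K _ _ _ (borel (K × K)) _ _ _ _ ν hν1 hν2 Prod.fst Prod.snd
    continuous_fst continuous_snd ?_ ?_ ?_
  · rintro U hU ⟨a, b⟩ hz
    obtain ⟨V, W, hV, hW, ha, hb, hs⟩ := isOpen_prod_iff.1 hU a b hz
    exact ⟨V, W, hV, hW, ⟨ha, hb⟩, fun x hx => hs ⟨hx.1, hx.2⟩⟩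
  · exact @map_radon_aux (K × K) K _ _ _ (borel (K × K)) _ ν hν1 hν2 h _ continuous_fst
  · exact @map_radon_aux (K × K) K _ _ _ (borel (K × K)) _ ν hν1 hν2 h _ continuous_snd
end
end

section
/- Let K be a compact Hausdorff space, μ a Radon probability measure on K, and ν a finitely additive probability measure on the rectangle algebra 𝓡 = Bor(K) ⊗ Bor(K) with marginals μ (i.e. ν(B×K) = ν(K×B) = μ(B) for every Borel B ⊆ K). Then ν is 𝓛-regular, where 𝓛 is the family of finite unions of rectangles F×F' with F, F' ⊆ K closed: for every A ∈ 𝓡 and every ε > 0 there is L ∈ 𝓛 with L ⊆ A and ν(A \ L) < ε. -/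
open MeasureTheory Set

noncomputable section

lemma aux_meas {K : Type*} [TopologicalSpace K] {F : Set K} (hF : IsClosed F) :
    MeasurableSet[borel K] F := by
  let _ : MeasurableSpace K := borel K
  have : BorelSpace K := ⟨rfl⟩
  exact hF.measurableSet

lemma aux_rect_mem (K : Type*) [TopologicalSpace K] {B C : Set K}
    (hB : MeasurableSet[borel K] B) (hC : MeasurableSet[borel K] C) :
    B ×ˢ C ∈ rectAlgebra K :=
  generateSetAlgebra.base _ ⟨B, hB, C, hC, rfl⟩

lemma aux_alg (K : Type*) [TopologicalSpace K] : IsSetAlgebra (rectAlgebra K) :=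
  isSetAlgebra_generateSetAlgebra

lemma aux_finite (K : Type*) [TopologicalSpace K] {ι : Type*} [Finite ι] (F F' : ι → Set K)
    (hF : ∀ i, IsClosed (F i)) (hF' : ∀ i, IsClosed (F' i)) :
    (⋃ i, F i ×ˢ F' i) ∈ closedRectUnions K := by
  obtain ⟨n, ⟨e⟩⟩ := Finite.exists_equiv_fin ι
  refine ⟨n, F ∘ e.symm, F' ∘ e.symm, fun i => hF _, fun i => hF' _, ?_⟩
  exact (e.symm.surjective.iUnion_comp (fun i => F i ×ˢ F' i)).symm

lemma aux_union (K : Type*) [TopologicalSpace K] {L M : Set (K × K)}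
    (hL : L ∈ closedRectUnions K) (hM : M ∈ closedRectUnions K) :
    L ∪ M ∈ closedRectUnions K := by
  obtain ⟨n, F, F', hF, hF', rfl⟩ := hL
  obtain ⟨m, G, G', hG, hG', rfl⟩ := hM
  have := aux_finite K (Sum.elim F G) (Sum.elim F' G')
    (by rintro (i | i) <;> simp [hF, hG]) (by rintro (i | i) <;> simp [hF', hG'])
  simpa [iUnion_sum] using this

lemma aux_inter (K : Type*) [TopologicalSpace K] {L M : Set (K × K)}
    (hL : L ∈ closedRectUnions K) (hM : M ∈ closedRectUnions K) :
    L ∩ M ∈ closedRectUnions K := by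
  obtain ⟨n, F, F', hF, hF', rfl⟩ := hL
  obtain ⟨m, G, G', hG, hG', rfl⟩ := hM
  have := aux_finite K (fun p : Fin n × Fin m => F p.1 ∩ G p.2) (fun p => F' p.1 ∩ G' p.2)
    (fun p => (hF _).inter (hG _)) (fun p => (hF' _).inter (hG' _))
  convert this using 1
  ext x
  simp only [mem_inter_iff, mem_iUnion, mem_prod, Prod.exists]
  constructor
  · rintro ⟨⟨i, h⟩, ⟨j, h'⟩⟩
    exact ⟨i, j, ⟨h.1, h'.1⟩, ⟨h.2, h'.2⟩⟩
  · rintro ⟨i, j, h, h'⟩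
    exact ⟨⟨i, h.1, h'.1⟩, ⟨j, h.2, h'.2⟩⟩

lemma aux_closedRect_mem (K : Type*) [TopologicalSpace K] {L : Set (K × K)}
    (hL : L ∈ closedRectUnions K) : L ∈ rectAlgebra K := by
  obtain ⟨n, F, F', hF, hF', rfl⟩ := hL
  have h : ∀ s : Finset (Fin n), (⋃ i ∈ s, F i ×ˢ F' i) ∈ rectAlgebra K := fun s =>
    (aux_alg K).biUnion_mem s fun i _ => aux_rect_mem K
      (aux_meas (hF i))
      (aux_meas (hF' i))
  simpa using h Finset.univ

lemma aux_mono {K : Type*} [TopologicalSpace K] {ν : Set (K × K) → ℝ}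
    (hν : IsFinAddProb (rectAlgebra K) ν) {S T : Set (K × K)} (hS : S ∈ rectAlgebra K)
    (hT : T ∈ rectAlgebra K) (h : S ⊆ T) : ν S ≤ ν T := by
  have hd := (aux_alg K).isSetRing.sdiff_mem hT hS
  have h1 := hν.2.2 S hS _ hd disjoint_sdiff_right
  rw [union_diff_cancel h] at h1
  linarith [hν.1 _ hd]

lemma aux_subadd {K : Type*} [TopologicalSpace K] {ν : Set (K × K) → ℝ}
    (hν : IsFinAddProb (rectAlgebra K) ν) {U S T : Set (K × K)} (hU : U ∈ rectAlgebra K)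
    (hS : S ∈ rectAlgebra K)
    (hT : T ∈ rectAlgebra K) (h : U ⊆ S ∪ T) : ν U ≤ ν S + ν T := by
  have hd := (aux_alg K).isSetRing.sdiff_mem hT hS
  have h1 := hν.2.2 S hS _ hd disjoint_sdiff_right
  have h2 := aux_mono hν hd hT diff_subset
  have h3 := aux_mono hν hU ((aux_alg K).union_mem hS hd) (by simpa using h)
  linarith

/-- Regularity of one set. -/
def auxReg {K : Type*} [TopologicalSpace K] (ν : Set (K × K) → ℝ) (A : Set (K × K)) : Prop :=
  A ∈ rectAlgebra K ∧ ∀ ε : ℝ, 0 < ε → ∃ L ∈ closedRectUnions K, L ⊆ A ∧ ν (A \ L) < ε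

lemma auxReg_union {K : Type*} [TopologicalSpace K] {ν : Set (K × K) → ℝ}
    (hν : IsFinAddProb (rectAlgebra K) ν) {A B : Set (K × K)} (hA : auxReg ν A)
    (hB : auxReg ν B) : auxReg ν (A ∪ B) := by
  have R := (aux_alg K).isSetRing
  refine ⟨R.union_mem hA.1 hB.1, fun ε hε => ?_⟩
  obtain ⟨L, hL, hLA, h1⟩ := hA.2 (ε / 2) (by linarith)
  obtain ⟨M, hM, hMB, h2⟩ := hB.2 (ε / 2) (by linarith)
  refine ⟨L ∪ M, aux_union K hL hM, union_subset_union hLA hMB, ?_⟩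
  have hL' := aux_closedRect_mem K hL
  have hM' := aux_closedRect_mem K hM
  have := aux_subadd hν (U := (A ∪ B) \ (L ∪ M))
    (R.sdiff_mem (R.union_mem hA.1 hB.1) (R.union_mem hL' hM'))
    (R.sdiff_mem hA.1 hL') (R.sdiff_mem hB.1 hM')
    (by intro x; simp only [mem_union, mem_sdiff]; tauto)
  linarith

lemma auxReg_inter {K : Type*} [TopologicalSpace K] {ν : Set (K × K) → ℝ}
    (hν : IsFinAddProb (rectAlgebra K) ν) {A B : Set (K × K)} (hA : auxReg ν A)
    (hB : auxReg ν B) : auxReg ν (A ∩ B) := by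
  have R := (aux_alg K).isSetRing
  have hI := (aux_alg K).inter_mem hA.1 hB.1
  refine ⟨hI, fun ε hε => ?_⟩
  obtain ⟨L, hL, hLA, h1⟩ := hA.2 (ε / 2) (by linarith)
  obtain ⟨M, hM, hMB, h2⟩ := hB.2 (ε / 2) (by linarith)
  refine ⟨L ∩ M, aux_inter K hL hM, inter_subset_inter hLA hMB, ?_⟩
  have := aux_subadd hν (U := (A ∩ B) \ (L ∩ M))
    (R.sdiff_mem hI (aux_closedRect_mem K (aux_inter K hL hM)))
    (R.sdiff_mem hA.1 (aux_closedRect_mem K hL)) (R.sdiff_mem hB.1 (aux_closedRect_mem K hM))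
    (by intro x; simp only [mem_union, mem_inter_iff, mem_sdiff]; tauto)
  linarith

lemma aux_inner {K : Type*} [TopologicalSpace K] [CompactSpace K] [T2Space K]
    (μ : RadonProb K) {B : Set K} (hB : MeasurableSet[borel K] B) {ε : ℝ} (hε : 0 < ε) :
    ∃ F ⊆ B, IsClosed F ∧ MeasurableSet[borel K] (B \ F) ∧ (μ.1 (B \ F)).toReal < ε := by
  let _ : MeasurableSpace K := borel K
  have : BorelSpace K := ⟨rfl⟩
  obtain ⟨μ, h1, h2⟩ := μ
  obtain ⟨F, hF, hc, h⟩ := hB.exists_isCompact_sdiff_lt (μ := μ) (measure_ne_top _ _)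
    (ε := ENNReal.ofReal ε) (by simpa using hε)
  exact ⟨F, hF, hc.isClosed, hB.diff hc.isClosed.measurableSet,
    (ENNReal.lt_ofReal_iff_toReal_lt (measure_ne_top _ _)).1 h⟩

lemma auxReg_left {K : Type*} [TopologicalSpace K] [CompactSpace K] [T2Space K]
    (μ : RadonProb K) {ν : Set (K × K) → ℝ} (hm : HasMarginals ν μ.1)
    {B : Set K} (hB : MeasurableSet[borel K] B) : auxReg ν (B ×ˢ (univ : Set K)) := by
  refine ⟨aux_rect_mem K hB MeasurableSet.univ, fun ε hε => ?_⟩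
  obtain ⟨F, hF, hc, hd, h⟩ := aux_inner μ hB hε
  refine ⟨F ×ˢ univ, ?_, prod_mono hF le_rfl, ?_⟩
  · exact ⟨1, fun _ => F, fun _ => univ, fun _ => hc, fun _ => isClosed_univ,
      (iUnion_const _).symm⟩
  · have e : (B ×ˢ (univ : Set K)) \ (F ×ˢ univ) = (B \ F) ×ˢ univ := by ext; simp
    rwa [e, (hm _ hd).1]

lemma auxReg_right {K : Type*} [TopologicalSpace K] [CompactSpace K] [T2Space K]
    (μ : RadonProb K) {ν : Set (K × K) → ℝ} (hm : HasMarginals ν μ.1)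
    {B : Set K} (hB : MeasurableSet[borel K] B) : auxReg ν ((univ : Set K) ×ˢ B) := by
  refine ⟨aux_rect_mem K MeasurableSet.univ hB, fun ε hε => ?_⟩
  obtain ⟨F, hF, hc, hd, h⟩ := aux_inner μ hB hε
  refine ⟨univ ×ˢ F, ?_, prod_mono le_rfl hF, ?_⟩
  · exact ⟨1, fun _ => univ, fun _ => F, fun _ => isClosed_univ, fun _ => hc,
      (iUnion_const _).symm⟩
  · have e : ((univ : Set K) ×ˢ B) \ (univ ×ˢ F) = univ ×ˢ (B \ F) := by ext; simp
    rwa [e, (hm _ hd).2]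

lemma aux_main {K : Type*} [TopologicalSpace K] [CompactSpace K] [T2Space K]
    (μ : RadonProb K) {ν : Set (K × K) → ℝ}
    (hν : IsFinAddProb (rectAlgebra K) ν) (hm : HasMarginals ν μ.1)
    {A : Set (K × K)} (hA : A ∈ rectAlgebra K) : auxReg ν A ∧ auxReg ν Aᶜ := by
  induction hA with
  | base s hs =>
    obtain ⟨B, hB, C, hC, rfl⟩ := hs
    constructor
    · have := auxReg_inter hν (auxReg_left μ hm hB) (auxReg_right μ hm hC)
      rwa [prod_inter_prod, inter_univ, univ_inter] at this
    · have := auxReg_union hν (auxReg_left μ hm (MeasurableSet.compl hB))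
        (auxReg_right μ hm (MeasurableSet.compl hC))
      rwa [← compl_prod_eq_union] at this
  | empty =>
    constructor
    · simpa using auxReg_left μ hm (@MeasurableSet.empty K (borel K))
    · simpa using auxReg_left μ hm (@MeasurableSet.univ K (borel K))
  | compl s _ ih => exact ⟨ih.2, by simpa using ih.1⟩
  | union s t _ _ ihs iht =>
    refine ⟨auxReg_union hν ihs.1 iht.1, ?_⟩
    rw [compl_union]
    exact auxReg_inter hν ihs.2 iht.2

/-- Every finitely additive probability measure on `𝓡 = Bor(K) ⊗ Bor(K)` with marginals `μ`
is `𝓛`-regular, where `𝓛` is the family of finite unions of closed rectangles. -/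
theorem stmt15 (K : Type*) [TopologicalSpace K] [CompactSpace K] [T2Space K]
    (μ : RadonProb K) (ν : Set (K × K) → ℝ)
    (hν : IsFinAddProb (rectAlgebra K) ν) (hm : HasMarginals ν μ.1) :
    ∀ A ∈ rectAlgebra K, ∀ ε : ℝ, 0 < ε →
      ∃ L ∈ closedRectUnions K, L ⊆ A ∧ ν (A \ L) < ε := by
  exact fun A hA => (aux_main μ hν hm hA).1.2
end
end

section
/- For a compact Hausdorff space K the following are equivalent: (1) the Banach space C(K) of continuous real-valued functions on K with the supremum norm has property (C) of Corson; (2) for every family M ⊆ P(K) and every μ in the weak* closure of M there exists a countable subfamily N ⊆ M such that μ belongs to the weak* closed convex hull of N. -/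
open MeasureTheory Set

noncomputable section

def CountHull {E : Type*} [AddCommGroup E] [Module ℝ E] [TopologicalSpace E] (M : Set E) : Set E :=
  {z | ∃ N ⊆ M, N.Countable ∧ z ∈ closure (convexHull ℝ N)}

section TVS
variable {E : Type*} [AddCommGroup E] [Module ℝ E] [TopologicalSpace E]
  [IsTopologicalAddGroup E] [ContinuousSMul ℝ E]

theorem countHull_closed {M S : Set E} (hS : S ⊆ CountHull M) (hc : S.Countable) :
    ∃ N ⊆ M, N.Countable ∧ closure (convexHull ℝ S) ⊆ closure (convexHull ℝ N) := by
  have hS' : ∀ s ∈ S, ∃ N ⊆ M, N.Countable ∧ s ∈ closure (convexHull ℝ N) := fun s hs => hS hs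
  choose! N hN1 hN2 hN3 using hS'
  refine ⟨⋃ s ∈ S, N s, by simpa using hN1, hc.biUnion hN2, ?_⟩
  refine closure_minimal (convexHull_min ?_ (convex_convexHull ℝ _).closure) isClosed_closure
  intro s hs
  exact closure_mono (convexHull_mono (subset_biUnion_of_mem hs)) (hN3 s hs)

theorem convex_countHull (M : Set E) : Convex ℝ (CountHull M) := by
  intro x hx y hy a b ha hb hab
  obtain ⟨N, h1, h2, h3⟩ := countHull_closed (M := M) (S := {x, y})
    (by intro z hz; rcases hz with rfl | rfl <;> assumption) (by simp)
  refine ⟨N, h1, h2, h3 ?_⟩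
  exact (convex_convexHull ℝ _).closure (subset_closure (subset_convexHull ℝ _ (by simp)))
    (subset_closure (subset_convexHull ℝ _ (by simp))) ha hb hab

theorem countHull_prod [T2Space E] [LocallyConvexSpace ℝ E] {A : Set E} (hA : IsCompact A)
    (hAc : Convex ℝ A)
    (H : ∀ M ⊆ A, closure M ⊆ CountHull M) {M : Set (E × E)} (hM : M ⊆ A ×ˢ A) :
    closure M ⊆ CountHull M := by
  have key : ∀ M : Set (E × E), M ⊆ A ×ˢ A → ∀ a b, (a, b) ∈ closure M →
      ∃ b', (a, b') ∈ CountHull M := by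
    intro M hM a b hab
    have hsub : Prod.fst '' M ⊆ A := by
      rintro _ ⟨z, hz, rfl⟩; exact (hM hz).1
    have ha : a ∈ closure (Prod.fst '' M) :=
      image_closure_subset_closure_image continuous_fst ⟨_, hab, rfl⟩
    obtain ⟨N, hN, hNc, haN⟩ := H _ hsub ha
    have hg : ∀ s ∈ N, ∃ z ∈ M, z.1 = s := fun s hs => hN hs
    choose! g hg1 hg2 using hg
    have hsub' : g '' N ⊆ M := by
      rintro _ ⟨s, hs, rfl⟩; exact hg1 s hs
    have hcomp : IsCompact (closure (convexHull ℝ (g '' N))) :=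
      (hA.prod hA).closure_of_subset (convexHull_min (hsub'.trans hM) (hAc.prod hAc))
    have hcl : IsClosed (Prod.fst '' closure (convexHull ℝ (g '' N))) :=
      (hcomp.image continuous_fst).isClosed
    have hcv : Convex ℝ (Prod.fst '' closure (convexHull ℝ (g '' N))) :=
      (convex_convexHull ℝ _).closure.linear_image (LinearMap.fst ℝ E E)
    have hin : N ⊆ Prod.fst '' closure (convexHull ℝ (g '' N)) := fun s hs =>
      ⟨g s, subset_closure (subset_convexHull ℝ _ ⟨s, hs, rfl⟩), hg2 s hs⟩
    obtain ⟨⟨a', b'⟩, hz, rfl⟩ := closure_minimal (convexHull_min hin hcv) hcl haN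
    exact ⟨b', g '' N, hsub', hNc.image g, hz⟩
  rintro ⟨a, b⟩ hab
  by_contra hnot
  set Zb : Set E := {b' | (a, b') ∈ CountHull M} with hZb
  have hZA : Zb ⊆ A := by
    rintro b' ⟨N, hN, -, h⟩
    have : closure (convexHull ℝ N) ⊆ A ×ˢ A :=
      closure_minimal (convexHull_min (hN.trans hM) (hAc.prod hAc)) (hA.prod hA).isClosed
    exact (this h).2
  have hZcl : IsClosed Zb := by
    refine isClosed_of_closure_subset fun b' hb' => ?_
    obtain ⟨N, hN, hNc, hbN⟩ := H _ hZA hb'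
    obtain ⟨N', h1, h2, h3⟩ := countHull_closed (M := M) (S := (fun b => (a, b)) '' N)
      (by rintro _ ⟨s, hs, rfl⟩; exact hN hs) (hNc.image _)
    refine ⟨N', h1, h2, h3 ?_⟩
    have hcl : IsClosed ((fun b => (a, b)) ⁻¹'
        closure (convexHull ℝ ((fun b => (a, b)) '' N))) :=
      isClosed_closure.preimage (by fun_prop)
    have hcv : Convex ℝ ((fun b => (a, b)) ⁻¹'
        closure (convexHull ℝ ((fun b => (a, b)) '' N))) := by
      intro x hx y hy s t hs ht hst
      have := (convex_convexHull ℝ ((fun b => (a, b)) '' N)).closure hx hy hs ht hst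
      simpa [← add_smul, hst] using this
    have hin : N ⊆ ((fun b => (a, b)) ⁻¹'
        closure (convexHull ℝ ((fun b => (a, b)) '' N))) := fun s hs =>
      subset_closure (subset_convexHull ℝ _ ⟨s, hs, rfl⟩)
    exact closure_minimal (convexHull_min hin hcv) hcl hbN
  have hZcv : Convex ℝ Zb := by
    intro x hx y hy s t hs ht hst
    have := convex_countHull M hx hy hs ht hst
    simpa [hZb, ← add_smul, hst] using this
  obtain ⟨f, u, hu1, hu2⟩ := geometric_hahn_banach_point_closed hZcv hZcl hnot
  have hO : IsOpen {z : E × E | f z.2 < u} :=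
    isOpen_lt (f.continuous.comp continuous_snd) continuous_const
  have hab' := hO.inter_closure ⟨hu1, hab⟩
  obtain ⟨b', N, hN, hNc, hb'⟩ := key _ (inter_subset_right.trans hM) a b hab'
  have h1 : b' ∈ Zb := ⟨N, hN.trans inter_subset_right, hNc, hb'⟩
  have h2 : closure (convexHull ℝ N) ⊆ {z : E × E | f z.2 ≤ u} := by
    refine closure_minimal (convexHull_min (fun z hz => le_of_lt (show f z.2 < u from (hN hz).1)) ?_)
      (isClosed_le (f.continuous.comp continuous_snd) continuous_const)
    exact convex_halfSpace_le (f := fun z : E × E => f z.2)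
      ((f.toLinearMap.comp (LinearMap.snd ℝ E E)).isLinear) u
  exact absurd (hu2 b' h1) (not_lt.2 (h2 hb'))
end TVS
def StateSet (K : Type*) [TopologicalSpace K] [CompactSpace K] : Set (WeakDual ℝ C(K, ℝ)) :=
  {φ | (∀ f : C(K, ℝ), 0 ≤ f → 0 ≤ φ f) ∧ φ 1 = 1}

section States
variable {K : Type*} [TopologicalSpace K] [CompactSpace K]

theorem pos_bound (φ : C(K, ℝ) →ₗ[ℝ] ℝ) (h : ∀ f : C(K, ℝ), 0 ≤ f → 0 ≤ φ f) (f : C(K, ℝ)) :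
    |φ f| ≤ ‖f‖ * φ 1 := by
  rw [abs_le]
  have h1 := h (‖f‖ • 1 - f) (fun x => by
    have := (abs_le.1 ((Real.norm_eq_abs _).symm.trans_le (f.norm_coe_le_norm x))).2
    simpa using this)
  have h2 := h (‖f‖ • 1 + f) (fun x => by
    have := (abs_le.1 ((Real.norm_eq_abs _).symm.trans_le (f.norm_coe_le_norm x))).1
    simp; linarith)
  simp only [map_sub, map_add, map_smul, smul_eq_mul] at h1 h2
  constructor <;> linarith

theorem isCompact_stateSet : IsCompact (StateSet K) := by
  refine (WeakDual.isCompact_closedBall (𝕜 := ℝ) (E := C(K, ℝ)) 0 1).of_isClosed_subset ?_ ?_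
  · have : StateSet K = (⋂ f : C(K, ℝ), ⋂ _ : 0 ≤ f, {φ : WeakDual ℝ C(K, ℝ) | 0 ≤ φ f}) ∩
        {φ | φ 1 = 1} := by ext; simp [StateSet]
    rw [this]
    refine (isClosed_iInter fun f => isClosed_iInter fun _ => ?_).inter ?_
    · exact isClosed_le continuous_const (WeakDual.eval_continuous f)
    · exact isClosed_eq (WeakDual.eval_continuous 1) continuous_const
  · rintro φ ⟨h1, h2⟩
    simp only [mem_preimage, Metric.mem_closedBall, dist_zero_right]
    refine ContinuousLinearMap.opNorm_le_bound _ zero_le_one fun f => ?_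
    have := pos_bound (WeakDual.toStrongDual φ).toLinearMap h1 f
    have h3 : (WeakDual.toStrongDual φ) 1 = 1 := h2
    simpa [h3] using this

theorem convex_stateSet : Convex ℝ (StateSet K) := by
  rintro φ ⟨h1, h2⟩ ψ ⟨h3, h4⟩ s t hs ht hst
  constructor
  · intro f hf
    have := h1 f hf
    have := h3 f hf
    change 0 ≤ s * φ f + t * ψ f
    positivity
  · change s * φ 1 + t * ψ 1 = 1
    rw [h2, h4]; linarith

/-- normalised functional -/
theorem exists_state (Φ : C(K, ℝ) →ₗ[ℝ] ℝ) (h : ∀ f : C(K, ℝ), 0 ≤ f → 0 ≤ Φ f)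
    (h1 : 0 < Φ 1) : ∃ φ ∈ StateSet K, ∀ f, φ f = Φ f / Φ 1 := by
  refine ⟨StrongDual.toWeakDual (((Φ 1)⁻¹ • Φ).mkContinuous 1 ?_), ⟨?_, ?_⟩, ?_⟩
  · intro f
    have := pos_bound Φ h f
    simp only [LinearMap.smul_apply, smul_eq_mul, norm_mul, norm_inv, Real.norm_eq_abs, abs_of_pos h1]
    rw [inv_mul_le_iff₀ h1]; linarith
  · intro f hf
    have := h f hf
    change 0 ≤ (Φ 1)⁻¹ * Φ f
    positivity
  · change (Φ 1)⁻¹ * Φ 1 = 1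
    field_simp
  · intro f
    change (Φ 1)⁻¹ * Φ f = _
    field_simp

/-- `f ↦ f(x) - f(y)` -/
def diffMap : C(K, ℝ) →ₗ[ℝ] C(K × K, ℝ) where
  toFun f := f.comp ContinuousMap.fst - f.comp ContinuousMap.snd
  map_add' f g := by ext; simp; ring
  map_smul' c f := by ext; simp; ring

open scoped Pointwise in
theorem states_pair {Y : Submodule ℝ C(K, ℝ)} (h1 : 1 ∈ Y) {C : Set C(K, ℝ)}
    (hC : Convex ℝ C) (hne : C.Nonempty) {ε : ℝ} (hε : 0 < ε)
    (hd : ∀ y ∈ Y, ∀ c ∈ C, ε ≤ ‖c - y‖) :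
    ∃ φ ∈ StateSet K, ∃ ψ ∈ StateSet K, (∀ y ∈ Y, φ y = ψ y) ∧ ∀ c ∈ C, ε ≤ φ c - ψ c := by
  obtain ⟨c₀, hc₀⟩ := hne
  have : Nonempty K := by
    by_contra hK
    rw [not_nonempty_iff] at hK
    have := hd 0 Y.zero_mem c₀ hc₀
    have h0 : c₀ = 0 := by ext x; exact hK.elim x
    simp [h0] at this; linarith
  let x₀ : K := Classical.arbitrary K
  let U : Set C(K × K, ℝ) := {h | ∀ z, h z < ε}
  have hUo : IsOpen U := by
    have := ContinuousMap.isOpen_setOfPred_mapsTo (X := K × K) (Y := ℝ) isCompact_univ (isOpen_Iio (a := ε))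
    convert this using 1
    ext h; simp [U, MapsTo]
  have hUc : Convex ℝ U := by
    intro f hf g hg s t hs ht hst z
    have := convex_Iio ε (hf z) (hg z) hs ht hst
    simpa using this
  let D : Set C(K × K, ℝ) := diffMap '' (C - (Y : Set C(K, ℝ)))
  have hDc : Convex ℝ D := (hC.sub Y.convex).linear_image diffMap
  have hdisj : Disjoint U D := by
    rw [Set.disjoint_left]
    rintro _ hU ⟨_, ⟨c, hc, y, hy, rfl⟩, rfl⟩
    have hlt : ‖c - (y + (c x₀ - y x₀) • (1 : C(K, ℝ)))‖ < ε := by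
      rw [ContinuousMap.norm_lt_iff _ hε]
      intro x
      have a1 := hU (x, x₀)
      have a2 := hU (x₀, x)
      simp [diffMap] at a1 a2
      rw [Real.norm_eq_abs, abs_lt]
      simp
      constructor <;> linarith
    exact absurd hlt (not_lt.2 (hd _ (Y.add_mem hy (Y.smul_mem _ h1)) c hc))
  obtain ⟨Φ, u, hΦ1, hΦ2⟩ := geometric_hahn_banach_open hUc hUo hDc hdisj
  have hu : 0 < u := by
    have := hΦ1 0 (by simpa [U] using hε)
    simpa using this
  have hpos : ∀ h : C(K × K, ℝ), 0 ≤ h → 0 ≤ Φ h := by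
    intro h hh
    by_contra hneg
    push Not at hneg
    have hmem : (u / Φ h) • h ∈ U := by
      intro z
      have q1 : u / Φ h ≤ 0 := (div_neg_of_pos_of_neg hu hneg).le
      have q2 : 0 ≤ h z := hh z
      have : (u / Φ h) * h z ≤ 0 := mul_nonpos_of_nonpos_of_nonneg q1 q2
      simp; linarith
    have := hΦ1 _ hmem
    rw [map_smul, smul_eq_mul, div_mul_cancel₀ _ hneg.ne] at this
    exact lt_irrefl _ this
  have hD0 := hΦ2 (diffMap (c₀ - 0)) ⟨_, ⟨c₀, hc₀, 0, Y.zero_mem, rfl⟩, rfl⟩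
  have hm : 0 < Φ 1 := by
    refine lt_of_le_of_ne (hpos 1 (fun z => by simp)) fun h0 => ?_
    have := pos_bound Φ.toLinearMap hpos (diffMap (c₀ - 0))
    change |Φ _| ≤ _ * Φ 1 at this
    rw [← h0, mul_zero] at this
    have := abs_le.1 this
    linarith
  have hum : ε * Φ 1 ≤ u := by
    by_contra hlt
    push Not at hlt
    have : (u / Φ 1) • (1 : C(K × K, ℝ)) ∈ U := by
      intro z
      simp
      rw [div_lt_iff₀ hm]; exact hlt
    have := hΦ1 _ this
    rw [map_smul, smul_eq_mul, div_mul_cancel₀ _ hm.ne'] at this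
    exact lt_irrefl _ this
  have e1 : (1 : C(K, ℝ)).comp (ContinuousMap.fst : C(K × K, K)) = 1 := rfl
  have e2 : (1 : C(K, ℝ)).comp (ContinuousMap.snd : C(K × K, K)) = 1 := rfl
  let Φ₁ : C(K, ℝ) →ₗ[ℝ] ℝ :=
    { toFun := fun f => Φ (f.comp ContinuousMap.fst)
      map_add' := fun f g => by rw [ContinuousMap.add_comp, map_add]
      map_smul' := fun c f => by rw [ContinuousMap.smul_comp, map_smul]; rfl }
  let Φ₂ : C(K, ℝ) →ₗ[ℝ] ℝ :=
    { toFun := fun f => Φ (f.comp ContinuousMap.snd)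
      map_add' := fun f g => by rw [ContinuousMap.add_comp, map_add]
      map_smul' := fun c f => by rw [ContinuousMap.smul_comp, map_smul]; rfl }
  obtain ⟨φ, hφ, hφ'⟩ := exists_state Φ₁ (fun f hf => hpos _ fun z => hf z.1) hm
  obtain ⟨ψ, hψ, hψ'⟩ := exists_state Φ₂ (fun f hf => hpos _ fun z => hf z.2) hm
  have hsub : ∀ f, φ f - ψ f = Φ (diffMap f) / Φ 1 := by
    intro f
    rw [hφ', hψ']
    change Φ (f.comp ContinuousMap.fst) / Φ 1 - Φ (f.comp ContinuousMap.snd) / Φ 1 =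
      Φ (f.comp ContinuousMap.fst - f.comp ContinuousMap.snd) / Φ 1
    rw [map_sub, sub_div]
  refine ⟨φ, hφ, ψ, hψ, ?_, ?_⟩
  · intro y hy
    rw [← sub_eq_zero, hsub]
    suffices Φ (diffMap y) = 0 by simp [this]
    by_contra hne
    set r := Φ (diffMap (c₀ - 0)) / Φ (diffMap y) with hr
    have := hΦ2 (diffMap (c₀ - r • y)) ⟨_, ⟨c₀, hc₀, r • y, Y.smul_mem _ hy, rfl⟩, rfl⟩
    rw [map_sub, map_smul, map_sub, map_smul, smul_eq_mul, hr, div_mul_cancel₀ _ hne] at this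
    simp at this
    linarith
  · intro c hc
    have := hΦ2 (diffMap (c - 0)) ⟨_, ⟨c, hc, 0, Y.zero_mem, rfl⟩, rfl⟩
    rw [sub_zero] at this
    rw [hsub, le_div_iff₀ hm]
    linarith
end States

section Repr
variable {K : Type*} [TopologicalSpace K] [CompactSpace K] [T2Space K]

theorem integrable_radon (μ : RadonProb K) (f : C(K, ℝ)) : Integrable f μ.1 := by
  let : MeasurableSpace K := borel K
  have : BorelSpace K := ⟨rfl⟩
  have := μ.2.1
  exact f.continuous.integrable_of_hasCompactSupport (HasCompactSupport.of_compactSpace f)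

theorem exists_radonState (μ : RadonProb K) :
    ∃ φ ∈ StateSet K, ∀ f : C(K, ℝ), φ f = @integral K ℝ _ _ (borel K) μ.1 f := by
  let : MeasurableSpace K := borel K
  have : BorelSpace K := ⟨rfl⟩
  have := μ.2.1
  let Φ : C(K, ℝ) →ₗ[ℝ] ℝ :=
    { toFun := fun f => ∫ x, f x ∂μ.1
      map_add' := fun f g => integral_add (integrable_radon μ f) (integrable_radon μ g)
      map_smul' := fun c f => integral_smul c f }
  have h1 : Φ 1 = 1 := by simp [Φ]
  obtain ⟨φ, hφ, h⟩ := exists_state Φ (fun f hf => integral_nonneg hf) (by rw [h1]; exact one_pos)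
  refine ⟨φ, hφ, fun f => ?_⟩
  rw [h, h1, div_one]; rfl

/-- The state of a Radon probability measure. -/
def radonState (μ : RadonProb K) : WeakDual ℝ C(K, ℝ) := (exists_radonState μ).choose

theorem radonState_mem (μ : RadonProb K) : radonState μ ∈ StateSet K :=
  (exists_radonState μ).choose_spec.1

theorem radonState_apply (μ : RadonProb K) (f : C(K, ℝ)) :
    radonState μ f = @integral K ℝ _ _ (borel K) μ.1 f :=
  (exists_radonState μ).choose_spec.2 f

theorem isInducing_radonState : Topology.IsInducing (radonState (K := K)) := by
  constructor
  have : (fun (μ : RadonProb K) (g : C(K, ℝ)) => @integral K ℝ _ _ (borel K) μ.1 g) =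
      (fun (φ : WeakDual ℝ C(K, ℝ)) (g : C(K, ℝ)) => φ g) ∘ radonState := by
    funext μ g; exact (radonState_apply μ g).symm
  change TopologicalSpace.induced
    (fun (μ : RadonProb K) (g : C(K, ℝ)) => @integral K ℝ _ _ (borel K) μ.1 g) inferInstance = _
  rw [this, ← induced_compose]
  rfl

theorem radonState_surj {φ : WeakDual ℝ C(K, ℝ)} (hφ : φ ∈ StateSet K) :
    ∃ μ : RadonProb K, radonState μ = φ := by
  let : MeasurableSpace K := borel K
  have : BorelSpace K := ⟨rfl⟩
  let Λ : CompactlySupportedContinuousMap K ℝ →ₚ[ℝ] ℝ := PositiveLinearMap.mk₀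
    { toFun := fun f => φ (f : C(K, ℝ))
      map_add' := fun f g => map_add φ (f : C(K, ℝ)) (g : C(K, ℝ))
      map_smul' := fun c f => map_smul φ c (f : C(K, ℝ)) }
    (fun f hf => hφ.1 _ fun x => hf x)
  have key : ∀ f : C(K, ℝ), ∫ x, f x ∂(RealRMK.rieszMeasure Λ) = φ f := fun f =>
    RealRMK.integral_rieszMeasure Λ (CompactlySupportedContinuousMap.continuousMapEquiv f)
  have hp : IsProbabilityMeasure (RealRMK.rieszMeasure Λ) := by
    have h1 := key 1
    rw [hφ.2] at h1
    simp [Measure.real] at h1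
    constructor
    rw [← ENNReal.toReal_eq_one_iff]; exact h1
  let ν : RadonProb K := ⟨RealRMK.rieszMeasure Λ, hp, inferInstance⟩
  refine ⟨ν, ?_⟩
  refine DFunLike.ext _ _ fun f => ?_
  exact (radonState_apply ν f).trans (key f)

theorem radonState_sum {n : ℕ} (t : Fin n → NNReal) (μs : Fin n → RadonProb K) (ν : RadonProb K)
    (h : ν.1 = ∑ i, ((t i : ENNReal) • (μs i).1)) :
    radonState ν = ∑ i, (t i : ℝ) • radonState (μs i) := by
  let : MeasurableSpace K := borel K
  have : BorelSpace K := ⟨rfl⟩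
  refine DFunLike.ext _ _ fun f => ?_
  have e : (∑ i, (t i : ℝ) • radonState (μs i)) f = ∑ i, (t i : ℝ) * radonState (μs i) f := by
    have : (∑ i, (t i : ℝ) • radonState (μs i)) f =
        (LinearMap.applyₗ f ∘ₗ ContinuousLinearMap.coeLM ℝ)
          (∑ i, (t i : ℝ) • WeakDual.toStrongDual (radonState (μs i))) := rfl
    rw [this, map_sum]; rfl
  rw [e, radonState_apply, h, integral_finsetSum_measure]
  · refine Finset.sum_congr rfl fun i _ => ?_
    rw [integral_smul_measure, radonState_apply]; rfl
  · intro i _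
    exact (integrable_radon (μs i) f).smul_measure ENNReal.coe_ne_top

theorem radonState_image_comb (N : Set (RadonProb K)) :
    radonState '' ConvexCombinations N = convexHull ℝ (radonState '' N) := by
  let : MeasurableSpace K := borel K
  have : BorelSpace K := ⟨rfl⟩
  apply Subset.antisymm
  · rintro _ ⟨ν, ⟨n, t, μs, h1, h2, h3⟩, rfl⟩
    rw [radonState_sum t μs ν h3]
    refine (convex_convexHull ℝ _).sum_mem (fun i _ => (t i).2) (by exact_mod_cast h2) fun i _ => ?_
    exact subset_convexHull ℝ _ ⟨_, h1 i, rfl⟩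
  · intro φ hφ
    rw [mem_convexHull_iff_exists_fintype] at hφ
    obtain ⟨ι, _, w, z, hw0, hw1, hz, rfl⟩ := hφ
    choose m hm1 hm2 using hz
    let e := Fintype.equivFin ι
    let t : Fin (Fintype.card ι) → NNReal := fun i => ⟨w (e.symm i), hw0 _⟩
    have ht : ∑ i, t i = 1 := by
      apply NNReal.coe_injective
      push_cast
      rw [← hw1]
      exact e.symm.sum_comp w
    let ν : Measure K := ∑ i, ((t i : ENNReal) • (m (e.symm i)).1)
    have hν : IsProbabilityMeasure ν := by
      constructor
      have : ∀ i, (m (e.symm i)).1 univ = 1 := fun i => (m (e.symm i)).2.1.measure_univ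
      simp only [ν, Measure.coe_finsetSum, Finset.sum_apply, Measure.smul_apply, this, smul_eq_mul, mul_one]
      exact_mod_cast ht
    have : ∀ i, Measure.InnerRegular (m (e.symm i)).1 := fun i => (m (e.symm i)).2.2
    have hν' : Measure.InnerRegular ν := inferInstance
    let ν' : RadonProb K := ⟨ν, hν, hν'⟩
    refine ⟨ν', ⟨_, t, fun i => m (e.symm i), fun i => hm1 _, ht, rfl⟩, ?_⟩
    refine (radonState_sum t (fun i => m (e.symm i)) ν' rfl).trans ?_
    simp only [hm2]
    exact e.symm.sum_comp (fun i => w i • z i)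

theorem mem_closure_radon {M : Set (RadonProb K)} {μ : RadonProb K} :
    μ ∈ closure M ↔ radonState μ ∈ closure (radonState '' M) := by
  rw [isInducing_radonState.closure_eq_preimage_closure_image]; rfl
end Repr

section Main
variable {K : Type*} [TopologicalSpace K] [CompactSpace K]

theorem weakDual_functional (Λ : StrongDual ℝ (WeakDual ℝ C(K, ℝ))) :
    ∃ g : C(K, ℝ), ∀ φ : WeakDual ℝ C(K, ℝ), Λ φ = φ g := by
  obtain ⟨g, hg⟩ := LinearMap.dualEmbedding_surjective
    (topDualPairing ℝ C(K, ℝ)) Λ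
  exact ⟨g, fun φ => (DFunLike.congr_fun hg φ).symm⟩

theorem locallyConvex_weakDual : LocallyConvexSpace ℝ (WeakDual ℝ C(K, ℝ)) :=
  (WeakDual.withSeminorms ℝ C(K, ℝ)).toLocallyConvexSpace

theorem forward (hC : PropertyC C(K, ℝ)) {M : Set (WeakDual ℝ C(K, ℝ))} (hM : M ⊆ StateSet K) :
    closure M ⊆ CountHull M := by
  intro μ hμ
  by_contra hnot
  have := locallyConvex_weakDual (K := K)
  have hμS : μ ∈ StateSet K := closure_minimal hM isCompact_stateSet.isClosed hμ
  let S : WeakDual ℝ C(K, ℝ) → Set C(K, ℝ) := fun ν => {f | μ f = 0 ∧ ν f ≤ -1}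
  have hlin : ∀ ν : WeakDual ℝ C(K, ℝ), IsLinearMap ℝ (fun f => ν f) := fun ν =>
    ⟨fun f g => map_add ν f g, fun c f => map_smul ν c f⟩
  have hcont : ∀ ν : WeakDual ℝ C(K, ℝ), Continuous (fun f => ν f) := fun ν =>
    (WeakDual.toStrongDual ν).continuous
  obtain ⟨f, hf⟩ := hC (S '' M) (by
    rintro _ ⟨ν, -, rfl⟩
    refine ⟨?_, ?_⟩
    · exact (isClosed_eq (hcont μ) continuous_const).inter
        (isClosed_le (hcont ν) continuous_const)
    · exact (convex_hyperplane (hlin μ) 0).inter (convex_halfSpace_le (hlin ν) (-1))) (by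
    intro 𝒟 h𝒟 h𝒟c
    have hg : ∀ D ∈ 𝒟, ∃ ν ∈ M, S ν = D := fun D hD => h𝒟 hD
    choose! g hg1 hg2 using hg
    have hn : μ ∉ closure (convexHull ℝ (g '' 𝒟)) := fun h =>
      hnot ⟨g '' 𝒟, by rintro _ ⟨D, hD, rfl⟩; exact hg1 D hD, h𝒟c.image g, h⟩
    obtain ⟨Λ, u, hu1, hu2⟩ := geometric_hahn_banach_closed_point
      (convex_convexHull ℝ _).closure isClosed_closure hn
    obtain ⟨f, hf⟩ := weakDual_functional Λ
    rw [hf] at hu2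
    set δ := μ f - u with hδ
    have hδ0 : 0 < δ := sub_pos.2 hu2
    have hval : ∀ ν ∈ StateSet K, ν (δ⁻¹ • (f - μ f • 1)) = δ⁻¹ * (ν f - μ f) := by
      intro ν hν
      rw [map_smul, map_sub, map_smul, hν.2]; simp
    refine ⟨δ⁻¹ • (f - μ f • 1), ?_⟩
    intro D hD
    rw [← hg2 D hD]
    refine ⟨?_, ?_⟩
    · rw [hval μ hμS]; simp
    · rw [hval _ (hM (hg1 D hD)), inv_mul_le_iff₀ hδ0]
      have := hu1 (g D) (subset_closure (subset_convexHull ℝ _ ⟨D, hD, rfl⟩))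
      rw [hf] at this
      linarith)
  have h1 : ∀ ν ∈ M, μ f = 0 ∧ ν f ≤ -1 := fun ν hν => hf (S ν) ⟨ν, hν, rfl⟩
  have h2 : μ f ≤ -1 := closure_minimal (fun ν hν => (h1 ν hν).2)
    (isClosed_le (WeakDual.eval_continuous f) continuous_const) hμ
  obtain ⟨ν, hν⟩ : M.Nonempty := closure_nonempty_iff.1 ⟨μ, hμ⟩
  have := (h1 ν hν).1
  linarith

/-- Families with the countable intersection property. -/
def GoodFam (𝒞 : Set (Set C(K, ℝ))) : Prop :=
  (∀ C ∈ 𝒞, IsClosed C ∧ Convex ℝ C) ∧ ∀ 𝒟 ⊆ 𝒞, 𝒟.Countable → (⋂₀ 𝒟).Nonempty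

theorem approx_point (H : ∀ M ⊆ StateSet K, closure M ⊆ CountHull M)
    {𝒞 : Set (Set C(K, ℝ))} (h𝒞 : GoodFam 𝒞) {ε : ℝ} (hε : 0 < ε) :
    ∃ x : C(K, ℝ), ∀ 𝒟 ⊆ 𝒞, 𝒟.Countable → (⋂₀ 𝒟 ∩ Metric.closedBall x ε).Nonempty := by
  by_contra hcon
  push Not at hcon
  choose 𝒟 h𝒟 h𝒟c h𝒟e using hcon
  have step : ∀ F : Finset C(K, ℝ), ∃ ℰ ⊆ 𝒞, ℰ.Countable ∧ ∃ φ ∈ StateSet K, ∃ ψ ∈ StateSet K,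
      (∀ y ∈ F, φ y = ψ y) ∧ ∀ c ∈ ⋂₀ ℰ, ε ≤ φ c - ψ c := by
    intro F
    let Y : Submodule ℝ C(K, ℝ) := Submodule.span ℝ (insert 1 (F : Set C(K, ℝ)))
    have hsep : TopologicalSpace.IsSeparable (Y : Set C(K, ℝ)) :=
      ((F.countable_toSet.insert 1).isSeparable).span (R := ℝ)
    obtain ⟨c, hc, hYc⟩ := hsep
    have hsub : (⋃ y ∈ c, 𝒟 y) ⊆ 𝒞 := by simpa using fun y _ => h𝒟 y
    have hcount : (⋃ y ∈ c, 𝒟 y).Countable := hc.biUnion fun y _ => h𝒟c y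
    refine ⟨⋃ y ∈ c, 𝒟 y, hsub, hcount, ?_⟩
    obtain ⟨φ, hφ, ψ, hψ, h1, h2⟩ := states_pair (Y := Y)
      (Submodule.subset_span (mem_insert _ _))
      (convex_sInter fun C hC => (h𝒞.1 C (hsub hC)).2) (h𝒞.2 _ hsub hcount) hε (by
        intro y hy x hx
        have hclosed : IsClosed {y : C(K, ℝ) | ε ≤ ‖x - y‖} :=
          isClosed_le continuous_const (by fun_prop)
        refine closure_minimal ?_ hclosed (hYc hy)
        intro z hz
        by_contra hlt
        have hmem : x ∈ ⋂₀ 𝒟 z ∩ Metric.closedBall z ε := by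
          refine ⟨fun D hD => hx D (mem_biUnion hz hD), ?_⟩
          rw [Metric.mem_closedBall, dist_eq_norm]
          exact (not_le.1 hlt).le
        rw [h𝒟e z] at hmem
        exact hmem)
    exact ⟨φ, hφ, ψ, hψ, fun y hy => h1 y (Submodule.subset_span (mem_insert_of_mem _ hy)), h2⟩
  choose ℰ hℰ hℰc φ hφ ψ hψ heq hge using step
  have := locallyConvex_weakDual (K := K)
  let p : Finset C(K, ℝ) → WeakDual ℝ C(K, ℝ) × WeakDual ℝ C(K, ℝ) := fun F => (φ F, ψ F)
  have hp : range p ⊆ StateSet K ×ˢ StateSet K := by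
    rintro _ ⟨F, rfl⟩; exact ⟨hφ F, hψ F⟩
  obtain ⟨⟨a, b⟩, -, hab⟩ := (isCompact_stateSet.prod isCompact_stateSet).exists_mapClusterPt
    (f := Filter.atTop) (u := p)
    (Filter.le_principal_iff.2 (Filter.mem_map.2 (Filter.univ_mem' fun F => ⟨hφ F, hψ F⟩)))
  have hab' : a = b := by
    refine DFunLike.ext _ _ fun f => ?_
    have hcl : IsClosed {z : WeakDual ℝ C(K, ℝ) × WeakDual ℝ C(K, ℝ) | z.1 f = z.2 f} :=
      isClosed_eq ((WeakDual.eval_continuous f).comp continuous_fst)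
        ((WeakDual.eval_continuous f).comp continuous_snd)
    refine hcl.mem_of_mapClusterPt hab ?_
    filter_upwards [Filter.eventually_ge_atTop {f}] with F hF
    exact heq F f (hF (Finset.mem_singleton_self f))
  subst hab'
  have hmem : (a, a) ∈ closure (range p) :=
    isClosed_closure.mem_of_mapClusterPt hab
      (Filter.Eventually.of_forall fun F => subset_closure (mem_range_self F))
  obtain ⟨N, hN, hNc, haN⟩ := countHull_prod isCompact_stateSet convex_stateSet H hp hmem
  have hg : ∀ z ∈ N, ∃ F, p F = z := fun z hz => hN hz
  choose! g hg using hg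
  obtain ⟨x, hx⟩ := h𝒞.2 (⋃ z ∈ N, ℰ (g z)) (by simpa using fun z _ => hℰ (g z))
    (hNc.biUnion fun z _ => hℰc _)
  have hsub : closure (convexHull ℝ N) ⊆
      {z : WeakDual ℝ C(K, ℝ) × WeakDual ℝ C(K, ℝ) | ε ≤ z.1 x - z.2 x} := by
    refine closure_minimal (convexHull_min ?_ ?_) ?_
    · intro z hz
      have := hge (g z) x (fun D hD => hx D (mem_biUnion hz hD))
      rw [← hg z hz]
      exact this
    · refine convex_halfSpace_ge (f := fun z : WeakDual ℝ C(K, ℝ) × WeakDual ℝ C(K, ℝ) =>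
        z.1 x - z.2 x) ⟨?_, ?_⟩ ε
      · intro z w
        change (z.1 x + w.1 x) - (z.2 x + w.2 x) = _
        ring
      · intro c z
        change c * z.1 x - c * z.2 x = c * (z.1 x - z.2 x)
        ring
    · exact isClosed_le continuous_const (((WeakDual.eval_continuous x).comp continuous_fst).sub
        ((WeakDual.eval_continuous x).comp continuous_snd))
  have : ε ≤ a x - a x := hsub haN
  linarith

theorem backward (H : ∀ M ⊆ StateSet K, closure M ⊆ CountHull M) : PropertyC C(K, ℝ) := by
  intro 𝒞 h1 h2
  have step : ∀ (n : ℕ) (𝒜 : {𝒜 : Set (Set C(K, ℝ)) // GoodFam 𝒜}),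
      ∃ ℬ : {𝒜 : Set (Set C(K, ℝ)) // GoodFam 𝒜}, 𝒜.1 ⊆ ℬ.1 ∧
        ∃ x, Metric.closedBall x ((1 / 2 : ℝ) ^ n) ∈ ℬ.1 := by
    rintro n ⟨𝒜, h𝒜⟩
    obtain ⟨x, hx⟩ := approx_point H h𝒜 (ε := (1 / 2 : ℝ) ^ n) (by positivity)
    refine ⟨⟨insert (Metric.closedBall x ((1 / 2 : ℝ) ^ n)) 𝒜, ?_, ?_⟩, subset_insert _ _, x,
      mem_insert _ _⟩
    · rintro C (rfl | hC)
      · exact ⟨Metric.isClosed_closedBall, convex_closedBall _ _⟩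
      · exact h𝒜.1 C hC
    · intro 𝒟 h𝒟 h𝒟c
      obtain ⟨y, hy1, hy2⟩ := hx (𝒟 ∩ 𝒜) inter_subset_right (h𝒟c.mono inter_subset_left)
      refine ⟨y, fun D hD => ?_⟩
      rcases h𝒟 hD with rfl | hD'
      · exact hy2
      · exact hy1 D ⟨hD, hD'⟩
  choose next hnext x hx using step
  let fam : ℕ → {𝒜 : Set (Set C(K, ℝ)) // GoodFam 𝒜} := fun n =>
    Nat.rec ⟨𝒞, h1, h2⟩ (fun n 𝒜 => next n 𝒜) n
  have hmono : Monotone fun n => (fam n).1 := monotone_nat_of_le_succ fun n => hnext n (fam n)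
  let c : ℕ → C(K, ℝ) := fun n => x n (fam n)
  have hball : ∀ n, Metric.closedBall (c n) ((1 / 2 : ℝ) ^ n) ∈ (fam (n + 1)).1 :=
    fun n => hx n (fam n)
  have hpair : ∀ n, ∀ A ∈ (fam n).1, ∀ B ∈ (fam n).1, (A ∩ B).Nonempty := by
    intro n A hA B hB
    have := (fam n).2.2 {A, B} (by rintro D (rfl | rfl) <;> assumption) (by simp)
    simpa using this
  have hcauchy : CauchySeq c := by
    refine cauchySeq_of_le_geometric (1 / 2) 2 (by norm_num) fun n => ?_
    obtain ⟨y, hy1, hy2⟩ := hpair (n + 2) _ (hmono (show n + 1 ≤ n + 2 by omega) (hball n)) _ (hball (n + 1))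
    rw [Metric.mem_closedBall] at hy1 hy2
    have := dist_triangle_left (c n) (c (n + 1)) y
    have h3 : (1 / 2 : ℝ) ^ (n + 1) ≤ (1 / 2) ^ n :=
      pow_le_pow_of_le_one (by norm_num) (by norm_num) (by omega)
    linarith
  obtain ⟨l, hl⟩ := cauchySeq_tendsto_of_complete hcauchy
  refine ⟨l, fun C hC => ?_⟩
  have hC' : ∀ n, ∃ y ∈ C, dist y (c n) ≤ (1 / 2 : ℝ) ^ n := by
    intro n
    obtain ⟨y, hy1, hy2⟩ := hpair (n + 1) C (hmono (Nat.zero_le (n + 1)) hC) _ (hball n)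
    exact ⟨y, hy1, hy2⟩
  choose y hy1 hy2 using hC'
  refine (h1 C hC).1.mem_of_tendsto (f := y) (b := Filter.atTop) ?_
    (Filter.Eventually.of_forall hy1)
  refine (tendsto_iff_of_dist ?_).2 hl
  exact squeeze_zero (fun _ => dist_nonneg) hy2
    (tendsto_pow_atTop_nhds_zero_of_lt_one (by norm_num) (by norm_num))
end Main

/-- Pol's characterization: `C(K)` has property (C) iff for every `M ⊆ P(K)` and every `μ` in
the weak* closure of `M` there is a countable `N ⊆ M` with `μ` in the weak* closed convex
hull of `N`. -/
theorem stmt16 (K : Type*) [TopologicalSpace K] [CompactSpace K] [T2Space K] :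
    PropertyC C(K, ℝ) ↔
    ∀ (M : Set (RadonProb K)) (μ : RadonProb K), μ ∈ closure M →
      ∃ N ⊆ M, N.Countable ∧ μ ∈ closure (ConvexCombinations N) := by
  constructor
  · intro hC M μ hμ
    rw [mem_closure_radon] at hμ
    obtain ⟨N, hN, hNc, h⟩ := forward hC (M := radonState '' M)
      (by rintro _ ⟨ν, -, rfl⟩; exact radonState_mem ν) hμ
    have hg : ∀ z ∈ N, ∃ ν ∈ M, radonState ν = z := fun z hz => hN hz
    have : Nonempty (RadonProb K) := ⟨μ⟩
    choose! g hg1 hg2 using hg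
    refine ⟨g '' N, by rintro _ ⟨z, hz, rfl⟩; exact hg1 z hz, hNc.image g, ?_⟩
    rw [mem_closure_radon, radonState_image_comb]
    have : radonState '' (g '' N) = N := by
      rw [image_image, image_congr hg2, image_id']
    rwa [this]
  · intro H
    refine backward fun M hM φ hφ => ?_
    have hφS : φ ∈ StateSet K := closure_minimal hM isCompact_stateSet.isClosed hφ
    obtain ⟨μ, rfl⟩ := radonState_surj hφS
    have himg : radonState '' (radonState ⁻¹' M) = M :=
      image_preimage_eq_of_subset fun ψ hψ => radonState_surj (hM hψ)
    obtain ⟨N, hN, hNc, h⟩ := H (radonState ⁻¹' M) μ (by rwa [mem_closure_radon, himg])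
    rw [mem_closure_radon, radonState_image_comb] at h
    exact ⟨radonState '' N, by rintro _ ⟨ν, hν, rfl⟩; exact hN hν, hNc.image _, h⟩
end
end

section
/- Let K be a compact Hausdorff space and assume that every Radon probability measure μ ∈ P(K) has countable Maharam type. Then P(K) with the weak* topology has countable tightness if and only if the Banach space C(K) of continuous real-valued functions on K with the supremum norm has property (C) of Corson. -/
open MeasureTheory Set

noncomputable section

set_option linter.unusedSectionVars false
set_option linter.style.haveILetI false

namespace RadonProb

variable {K : Type*} [TopologicalSpace K] [CompactSpace K] [T2Space K]

lemma integrable_coe (μ : RadonProb K) (g : C(K, ℝ)) :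
    letI : MeasurableSpace K := borel K
    Integrable (fun x => g x) μ.1 := by
  letI : MeasurableSpace K := borel K
  haveI : BorelSpace K := ⟨rfl⟩
  haveI : IsProbabilityMeasure μ.1 := μ.2.1
  exact (BoundedContinuousFunction.mkOfCompact g).integrable μ.1

/-- integration as a linear functional -/
def L (μ : RadonProb K) : C(K, ℝ) →ₗ[ℝ] ℝ where
  toFun g := ∫ x, g x ∂μ.1
  map_add' f g := by
    letI : MeasurableSpace K := borel K
    exact integral_add (integrable_coe μ f) (integrable_coe μ g)
  map_smul' c g := by
    letI : MeasurableSpace K := borel K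
    exact integral_const_mul c _

lemma L_apply (μ : RadonProb K) (g : C(K, ℝ)) : μ.L g = ∫ x, g x ∂μ.1 := rfl

lemma L_nonneg (μ : RadonProb K) {g : C(K, ℝ)} (hg : 0 ≤ g) : 0 ≤ μ.L g := by
  letI : MeasurableSpace K := borel K
  exact integral_nonneg (fun x => hg x)

lemma L_mono (μ : RadonProb K) {f g : C(K, ℝ)} (hg : f ≤ g) : μ.L f ≤ μ.L g := by
  have := μ.L_nonneg (sub_nonneg.2 hg)
  rw [map_sub] at this
  linarith

lemma abs_L_le (μ : RadonProb K) (g : C(K, ℝ)) : |μ.L g| ≤ μ.L |g| := by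
  rw [abs_le]
  constructor
  · have := μ.L_mono (neg_le_abs g)
    rw [map_neg] at this
    linarith
  · exact μ.L_mono (le_abs_self g)

lemma continuous_L (g : C(K, ℝ)) : Continuous (fun μ : RadonProb K => μ.L g) :=
  (continuous_apply g).comp continuous_induced_dom

lemma exists_mem_lt {B : Set (RadonProb K)} {μ : RadonProb K} (h : μ ∈ closure B)
    (g : C(K, ℝ)) {c : ℝ} (hc : μ.L g < c) : ∃ ν ∈ B, ν.L g < c := by
  obtain ⟨ν, h1, h2⟩ := mem_closure_iff.1 h {ν | ν.L g < c}
    (isOpen_lt (continuous_L g) continuous_const) hc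
  exact ⟨ν, h2, h1⟩

lemma mem_closure_of {B : Set (RadonProb K)} {μ : RadonProb K}
    (h : ∀ (I : Finset C(K, ℝ)) (δ : ℝ), 0 < δ → ∃ ν ∈ B, ∀ g ∈ I, |ν.L g - μ.L g| < δ) :
    μ ∈ closure B := by
  rw [mem_closure_iff]
  rintro U ⟨V, hV, rfl⟩ hμ
  obtain ⟨I, u, hu, hI⟩ := isOpen_pi_iff.1 hV _ hμ
  have : ∀ᶠ δ in nhdsWithin (0:ℝ) (Ioi 0), ∀ g ∈ I, Metric.ball (μ.L g) δ ⊆ u g := by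
    rw [Filter.eventually_all_finset]
    intro g hg
    obtain ⟨r, hr, hr'⟩ := Metric.isOpen_iff.1 (hu g hg).1 _ (hu g hg).2
    filter_upwards [Ioo_mem_nhdsGT hr] with δ hδ
    exact (Metric.ball_subset_ball hδ.2.le).trans hr'
  obtain ⟨δ, h1, h2⟩ := (this.and self_mem_nhdsWithin).exists
  obtain ⟨ν, hν, hν'⟩ := h I δ h2
  exact ⟨ν, hI fun g hg => h1 g hg (by rw [Metric.mem_ball, Real.dist_eq]; exact hν' g hg), hν⟩

lemma exists_countable_dense (μ : RadonProb K) (hμ : HasCountableType μ.1) :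
    ∃ G : Set C(K, ℝ), G.Countable ∧ ∀ h : C(K, ℝ), ∀ δ : ℝ, 0 < δ → ∃ g ∈ G, μ.L |h - g| < δ := by
  letI : MeasurableSpace K := borel K
  haveI : BorelSpace K := ⟨rfl⟩
  haveI : IsProbabilityMeasure μ.1 := μ.2.1
  obtain ⟨𝒞, h1, h2, h3⟩ := hμ
  haveI : IsSeparable μ.1 := ⟨𝒞, h1, h2, fun s hs _ ε hε => h3 s hs _ (by simpa using hε)⟩
  let T : C(K, ℝ) → Lp ℝ 1 μ.1 := fun g => (integrable_coe μ g).toL1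
  haveI : Fact ((1 : ENNReal) ≠ ⊤) := ⟨by simp⟩
  obtain ⟨t, ht, htc, htd⟩ := (TopologicalSpace.IsSeparable.of_separableSpace (range T)).exists_countable_dense_subset
  choose! s hs using (fun x (hx : x ∈ t) => ht hx)
  refine ⟨s '' t, htc.image s, fun h δ hδ => ?_⟩
  obtain ⟨b, hb, hb'⟩ := Metric.mem_closure_iff.1 (htd ⟨h, rfl⟩) δ hδ
  refine ⟨s b, ⟨b, hb, rfl⟩, ?_⟩
  rw [← hs b hb, dist_eq_norm, ← Integrable.toL1_sub, L1.norm_of_fun_eq_integral_norm] at hb'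
  exact hb'

end RadonProb
open RadonProb

section
variable {K : Type*} [TopologicalSpace K] [CompactSpace K] [T2Space K]

lemma C_lemma (hC : PropertyC C(K, ℝ)) {A : Set (RadonProb K)} {μ : RadonProb K}
    (hA : μ ∈ closure A) : ∃ B ⊆ A, B.Countable ∧
      ∀ f : C(K, ℝ), ∀ δ : ℝ, 0 < δ → ∃ ν ∈ B, ν.L f < μ.L f + δ := by
  by_contra! hcon
  have hcontL : ∀ ν : RadonProb K, Continuous ν.L := fun ν =>
    AddMonoidHomClass.continuous_of_bound ν.L 1 (fun g => by
      rw [Real.norm_eq_abs, one_mul]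
      refine (ν.abs_L_le g).trans ?_
      letI : MeasurableSpace K := borel K
      haveI : IsProbabilityMeasure ν.1 := ν.2.1
      have := ν.L_mono (f := |g|) (g := ContinuousMap.const K ‖g‖) (fun x => g.norm_coe_le_norm x)
      rw [L_apply ν (ContinuousMap.const K ‖g‖)] at this
      simpa using this)
  let S : RadonProb K → Set C(K, ℝ) := fun ν => {f | 1 + μ.L f ≤ ν.L f}
  have key := hC (S '' A) ?_ ?_
  · obtain ⟨f, hf⟩ := key
    obtain ⟨ν, hν, h1⟩ := exists_mem_lt hA f (c := 1 + μ.L f) (by linarith)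
    have : 1 + μ.L f ≤ ν.L f := hf (S ν) ⟨ν, hν, rfl⟩
    linarith
  · rintro _ ⟨ν, -, rfl⟩
    refine ⟨isClosed_le ((continuous_const).add (hcontL μ)) (hcontL ν), ?_⟩
    intro f hf g hg a b ha hb hab
    simp only [S, mem_ofPred_eq, map_add, map_smul, smul_eq_mul] at *
    nlinarith [mul_le_mul_of_nonneg_left hf ha, mul_le_mul_of_nonneg_left hg hb]
  · intro 𝒟 h𝒟 h𝒟c
    haveI : Nonempty (RadonProb K) := ⟨μ⟩
    choose! s hs hs' using (fun D (hD : D ∈ 𝒟) => h𝒟 hD)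
    obtain ⟨f, δ, hδ, hf⟩ := hcon (s '' 𝒟) (image_subset_iff.2 fun D hD => hs D hD) (h𝒟c.image s)
    refine ⟨δ⁻¹ • f, ?_⟩
    intro D hD
    rw [← hs' D hD]
    simp only [S, mem_ofPred_eq, map_smul, smul_eq_mul]
    have := hf (s D) ⟨D, hD, rfl⟩
    have h2 : δ⁻¹ * (μ.L f + δ) ≤ δ⁻¹ * (s D).L f := mul_le_mul_of_nonneg_left this (by positivity)
    have h3 : δ⁻¹ * δ = 1 := inv_mul_cancel₀ hδ.ne'
    linarith

lemma tight_of_C (h : ∀ μ : RadonProb K, HasCountableType μ.1) (hC : PropertyC C(K, ℝ)) :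
    CountablyTight (RadonProb K) := by
  intro A μ hA
  obtain ⟨G, hG, hGd⟩ := μ.exists_countable_dense (h μ)
  obtain ⟨g, rfl⟩ := hG.exists_eq_range (let ⟨g, hg, _⟩ := hGd 0 1 one_pos; ⟨g, hg⟩)
  let A' : ℕ → Set (RadonProb K) := fun k => A ∩ {ν | ∀ i ∈ Finset.range (k+1), |ν.L (g i) - μ.L (g i)| < 1 / (k + 1 : ℝ)}
  have hA' : ∀ k, μ ∈ closure (A' k) := by
    intro k
    have ho : IsOpen {ν : RadonProb K | ∀ i ∈ Finset.range (k+1), |ν.L (g i) - μ.L (g i)| < 1 / (k + 1 : ℝ)} := by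
      have : {ν : RadonProb K | ∀ i ∈ Finset.range (k+1), |ν.L (g i) - μ.L (g i)| < 1 / (k + 1 : ℝ)} =
        ⋂ i ∈ Finset.range (k+1), {ν : RadonProb K | |ν.L (g i) - μ.L (g i)| < 1 / (k + 1 : ℝ)} := by
        ext; simp
      rw [this]
      exact isOpen_biInter_finset fun i _ => isOpen_lt (((continuous_L _).sub continuous_const).abs) continuous_const
    refine closure_mono (by rw [inter_comm]) (ho.inter_closure ⟨?_, hA⟩)
    intro i _
    simp only [sub_self, abs_zero]
    positivity
  choose B hB hBc hBd using fun k => C_lemma hC (hA' k)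
  refine ⟨⋃ k, B k, iUnion_subset fun k => (hB k).trans inter_subset_left, countable_iUnion hBc, ?_⟩
  refine mem_closure_of fun I δ hδ => ?_
  set δ' := δ / (I.card + 3) with hδ'
  have hδ'0 : 0 < δ' := by positivity
  have : ∀ f : C(K, ℝ), ∃ i, μ.L |f - g i| < δ' := fun f => by
    obtain ⟨_, ⟨i, rfl⟩, hi⟩ := hGd f δ' hδ'0
    exact ⟨i, hi⟩
  choose i hi using this
  obtain ⟨k₀, hk₀⟩ := exists_nat_one_div_lt hδ'0
  let k := max k₀ (I.sup i)
  have hk : 1 / (k + 1 : ℝ) < δ' := by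
    refine lt_of_le_of_lt ?_ hk₀
    have : (k₀ : ℝ) ≤ k := by exact_mod_cast le_max_left _ _
    gcongr
  obtain ⟨ν, hν, hν'⟩ := hBd k (∑ f ∈ I, |f - g (i f)|) δ' hδ'0
  refine ⟨ν, mem_iUnion.2 ⟨k, hν⟩, fun f hf => ?_⟩
  have h1 : μ.L (∑ f ∈ I, |f - g (i f)|) ≤ I.card * δ' := by
    rw [map_sum, ← nsmul_eq_mul]
    exact Finset.sum_le_card_nsmul _ _ _ (fun f _ => (hi f).le)
  have h2 : ν.L |f - g (i f)| ≤ ν.L (∑ f ∈ I, |f - g (i f)|) :=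
    ν.L_mono (Finset.single_le_sum (f := fun f => |f - g (i f)|) (fun f _ => abs_nonneg _) hf)
  have h3 : |ν.L (g (i f)) - μ.L (g (i f))| < 1 / (k + 1 : ℝ) := by
    refine (hB k hν).2 (i f) ?_
    rw [Finset.mem_range]
    have := Finset.le_sup (f := i) hf
    have : I.sup i ≤ k := le_max_right _ _
    omega
  have h4 := (ν.abs_L_le (f - g (i f)))
  have h5 := (μ.abs_L_le (f - g (i f)))
  have h6 := hi f
  rw [map_sub] at h4 h5
  rw [abs_le] at h4 h5
  rw [abs_lt] at h3
  have h7 : δ = (I.card + 3) * δ' := by rw [hδ']; field_simp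
  rw [abs_lt, h7]
  constructor <;> linarith [h4.1, h4.2, h5.1, h5.2, h3.1, h3.2]
end

section
variable {K : Type*} [TopologicalSpace K] [CompactSpace K] [T2Space K]

/-- Riesz representation on a compact space. -/
lemma exists_radon (F : C(K, ℝ) →ₗ[ℝ] ℝ) (hF : ∀ g : C(K, ℝ), 0 ≤ g → 0 ≤ F g) (h1 : F 1 = 1) :
    ∃ μ : RadonProb K, ∀ g, μ.L g = F g := by
  letI : MeasurableSpace K := borel K
  haveI : BorelSpace K := ⟨rfl⟩
  let Λ : CompactlySupportedContinuousMap K ℝ →ₚ[ℝ] ℝ :=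
    { toFun := fun g => F g.toContinuousMap
      map_add' := fun f g => F.map_add f.toContinuousMap g.toContinuousMap
      map_smul' := fun c g => F.map_smul c g.toContinuousMap
      monotone' := fun f g hfg => by
        have := hF (g.toContinuousMap - f.toContinuousMap) (sub_nonneg.2 hfg)
        rw [map_sub] at this
        exact sub_nonneg.1 this }
  have hint : ∀ g : C(K, ℝ), ∫ x, g x ∂(RealRMK.rieszMeasure Λ) = F g := fun g =>
    RealRMK.integral_rieszMeasure Λ ⟨g, HasCompactSupport.of_compactSpace g⟩
  have hp : IsProbabilityMeasure (RealRMK.rieszMeasure Λ) := by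
    have := hint 1
    rw [h1] at this
    simp only [ContinuousMap.one_apply, integral_const, smul_eq_mul, mul_one] at this
    constructor
    rw [Measure.real, ENNReal.toReal_eq_one_iff] at this
    exact this
  exact ⟨⟨RealRMK.rieszMeasure Λ, hp, inferInstance⟩, hint⟩

/-- `P(K)` is compact. -/
instance compactSpace_radonProb : CompactSpace (RadonProb K) := by
  letI : MeasurableSpace K := borel K
  haveI : BorelSpace K := ⟨rfl⟩
  constructor
  rw [isCompact_iff_ultrafilter_le_nhds]
  intro 𝒰 _
  have hc : ∀ g : C(K, ℝ), ∃ c : ℝ, Filter.Tendsto (fun μ : RadonProb K => μ.L g) 𝒰 (nhds c) := by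
    intro g
    have : (Filter.map (fun μ : RadonProb K => μ.L g) 𝒰) ≤ Filter.principal (Icc (-‖g‖) ‖g‖) := by
      rw [Filter.le_principal_iff, Filter.mem_map]
      refine Filter.univ_mem' fun μ => ?_
      haveI : IsProbabilityMeasure μ.1 := μ.2.1
      have := μ.L_mono (f := |g|) (g := ContinuousMap.const K ‖g‖) (fun x => g.norm_coe_le_norm x)
      rw [L_apply μ (ContinuousMap.const K ‖g‖)] at this
      have := (μ.abs_L_le g).trans this
      simpa [abs_le] using this
    obtain ⟨c, -, hc⟩ := (isCompact_Icc (a := -‖g‖) (b := ‖g‖)).ultrafilter_le_nhds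
      (𝒰.map (fun μ : RadonProb K => μ.L g)) this
    exact ⟨c, hc⟩
  choose F hF using hc
  let F' : C(K, ℝ) →ₗ[ℝ] ℝ :=
    { toFun := F
      map_add' := fun f g => tendsto_nhds_unique (hF (f + g)) (by simpa using (hF f).add (hF g))
      map_smul' := fun c g => tendsto_nhds_unique (hF (c • g)) (by simpa using (hF g).const_mul c) }
  obtain ⟨μ, hμ⟩ := exists_radon F' (fun g hg => ge_of_tendsto' (hF g) fun ν => ν.L_nonneg hg)
    (tendsto_nhds_unique (hF 1) (by
      have : (fun ν : RadonProb K => ν.L 1) = fun _ => 1 := by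
        ext ν
        haveI : IsProbabilityMeasure ν.1 := ν.2.1
        rw [RadonProb.L_apply]
        simp
      rw [this]
      exact tendsto_const_nhds))
  refine ⟨μ, mem_univ _, ?_⟩
  rw [nhds_induced, ← Filter.map_le_iff_le_comap]
  change Filter.Tendsto _ _ _
  rw [tendsto_pi_nhds]
  intro g
  have := hF g
  have h2 : F g = ∫ x, g x ∂μ.1 := (hμ g).symm
  rw [h2] at this
  exact this

/-- States on `C(K) × C(K)` separating a convex set from a separable subspace. -/
lemma exists_state_s17 (S : Submodule ℝ C(K, ℝ)) (C : Set C(K, ℝ)) (hC : Convex ℝ C) (hne : C.Nonempty)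
    (ε : ℝ) (hε : 0 < ε) (hS : ∀ x ∈ S, ∀ y ∈ C, ε ≤ ‖y - x‖) :
    ∃ F : (C(K, ℝ) × C(K, ℝ)) →ₗ[ℝ] ℝ, (∀ w, 0 ≤ w → 0 ≤ F w) ∧ F (1, 1) = 1 ∧
      (∀ x ∈ S, F (x, -x) = 0) ∧ ∀ y ∈ C, ε ≤ F (y, -y) := by
  let O : Set (C(K, ℝ) × C(K, ℝ)) := {w | (∀ k, w.1 k < ε) ∧ ∀ k, w.2 k < ε}
  have hO : IsOpen O := by
    have h1 : IsOpen {u : C(K, ℝ) | ∀ k, u k < ε} := by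
      have := ContinuousMap.isOpen_setOfPred_mapsTo (X := K) (Y := ℝ) isCompact_univ (isOpen_Iio (a := ε))
      simpa [MapsTo] using this
    exact (h1.preimage continuous_fst).inter (h1.preimage continuous_snd)
  have hOc : Convex ℝ O := by
    rintro u ⟨hu1, hu2⟩ v ⟨hv1, hv2⟩ a b ha hb hab
    have key : ∀ p q : ℝ, p < ε → q < ε → a * p + b * q < ε := fun p q hp hq => by
      have := (convex_Iio ε) hp hq ha hb hab
      simpa using this
    exact ⟨fun k => by simpa using key _ _ (hu1 k) (hv1 k), fun k => by simpa using key _ _ (hu2 k) (hv2 k)⟩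
  let T : Set (C(K, ℝ) × C(K, ℝ)) := {w | ∃ x ∈ S, ∃ y ∈ C, w = (y - x, x - y)}
  have hTc : Convex ℝ T := by
    rintro _ ⟨x, hx, y, hy, rfl⟩ _ ⟨x', hx', y', hy', rfl⟩ a b ha hb hab
    refine ⟨a • x + b • x', S.add_mem (S.smul_mem _ hx) (S.smul_mem _ hx'), a • y + b • y',
      hC hy hy' ha hb hab, ?_⟩
    ext k <;> simp <;> ring
  have hd : Disjoint O T := by
    rw [Set.disjoint_left]
    rintro _ ⟨h1, h2⟩ ⟨x, hx, y, hy, rfl⟩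
    have := hS x hx y hy
    refine absurd this (not_le.2 ?_)
    rw [ContinuousMap.norm_lt_iff _ hε]
    intro k
    have h1 := h1 k
    have h2 := h2 k
    simp only [ContinuousMap.sub_apply] at h1 h2 ⊢
    rw [Real.norm_eq_abs, abs_lt]
    constructor <;> linarith
  obtain ⟨f, s, hf1, hf2⟩ := geometric_hahn_banach_open hOc hO hTc hd
  have hs : 0 < s := by
    have := hf1 0 ⟨fun k => by simpa using hε, fun k => by simpa using hε⟩
    simpa using this
  have hpos : ∀ w, 0 ≤ w → 0 ≤ f w := by
    intro w hw
    by_contra! hneg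
    have hm : (s / f w) • w ∈ O := by
      have hq : s / f w ≤ 0 := (div_neg_of_pos_of_neg hs hneg).le
      refine ⟨fun k => ?_, fun k => ?_⟩
      · have : (s / f w) * w.1 k ≤ 0 := mul_nonpos_of_nonpos_of_nonneg hq (hw.1 k)
        exact this.trans_lt hε
      · have : (s / f w) * w.2 k ≤ 0 := mul_nonpos_of_nonpos_of_nonneg hq (hw.2 k)
        exact this.trans_lt hε
    have := hf1 _ hm
    rw [map_smul, smul_eq_mul, div_mul_cancel₀ _ hneg.ne] at this
    exact lt_irrefl _ this
  have h11 : ε * f (1, 1) ≤ s := by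
    by_contra! hlt
    have hp : 0 < f (1, 1) := by
      by_contra! h0
      nlinarith
    have hq : s / f (1, 1) < ε := by rwa [div_lt_iff₀ hp]
    have := hf1 ((s / f (1, 1)) • (1, 1)) ⟨fun k => by simpa using hq, fun k => by simpa using hq⟩
    rw [map_smul, smul_eq_mul, div_mul_cancel₀ _ hp.ne'] at this
    exact lt_irrefl _ this
  have hT : ∀ x ∈ S, ∀ y ∈ C, s ≤ f (y, -y) - f (x, -x) := by
    intro x hx y hy
    have := hf2 _ ⟨x, hx, y, hy, rfl⟩
    have e : ((y - x, x - y) : C(K, ℝ) × C(K, ℝ)) = (y, -y) - (x, -x) := by ext <;> simp <;> ring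
    rwa [e, map_sub] at this
  obtain ⟨y₀, hy₀⟩ := hne
  have hp : 0 < f (1, 1) := by
    have h0 := hT 0 S.zero_mem y₀ hy₀
    have hle : 0 ≤ f (‖y₀‖ • (1, 1) - (y₀, -y₀)) := by
      refine hpos _ ⟨fun k => ?_, fun k => ?_⟩
      · have := (abs_le.1 (y₀.norm_coe_le_norm k)).2
        simpa using this
      · have := (abs_le.1 (y₀.norm_coe_le_norm k)).1
        simpa using (by linarith : 0 ≤ ‖y₀‖ + y₀ k)
    rw [map_sub, map_smul, smul_eq_mul] at hle
    have e : f ((0 : C(K, ℝ)), -(0 : C(K, ℝ))) = 0 := by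
      have : (((0 : C(K, ℝ)), -(0 : C(K, ℝ))) : C(K, ℝ) × C(K, ℝ)) = 0 := by ext <;> simp
      rw [this, map_zero]
    rw [e] at h0
    by_contra! hn
    nlinarith [norm_nonneg y₀]
  have hz : ∀ x ∈ S, f (x, -x) = 0 := by
    intro x hx
    by_contra hne
    have := hT ((f (y₀, -y₀) / f (x, -x)) • x) (S.smul_mem _ hx) y₀ hy₀
    have e : (((f (y₀, -y₀) / f (x, -x)) • x, -((f (y₀, -y₀) / f (x, -x)) • x)) : C(K, ℝ) × C(K, ℝ))
      = (f (y₀, -y₀) / f (x, -x)) • (x, -x) := by ext <;> simp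
    rw [e, map_smul, smul_eq_mul, div_mul_cancel₀ _ hne] at this
    linarith
  refine ⟨(f (1, 1))⁻¹ • f.toLinearMap, fun w hw => ?_, ?_, fun x hx => ?_, fun y hy => ?_⟩
  · have := hpos w hw
    simp only [LinearMap.smul_apply, ContinuousLinearMap.coe_coe, smul_eq_mul]
    positivity
  · simp only [LinearMap.smul_apply, ContinuousLinearMap.coe_coe, smul_eq_mul]
    exact inv_mul_cancel₀ hp.ne'
  · simp only [LinearMap.smul_apply, ContinuousLinearMap.coe_coe, smul_eq_mul, hz x hx, mul_zero]
  · simp only [LinearMap.smul_apply, ContinuousLinearMap.coe_coe, smul_eq_mul]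
    have := hT 0 S.zero_mem y hy
    rw [hz 0 S.zero_mem] at this
    rw [le_inv_mul_iff₀ hp]
    linarith

/-- CIP: countable intersection property for a family of closed convex sets. -/
def CIP {X : Type*} [NormedAddCommGroup X] [NormedSpace ℝ X] (𝒞 : Set (Set X)) : Prop :=
  (∀ C ∈ 𝒞, IsClosed C ∧ Convex ℝ C) ∧ (∀ 𝒟 ⊆ 𝒞, 𝒟.Countable → (⋂₀ 𝒟).Nonempty)

lemma key_step (h : ∀ μ : RadonProb K, HasCountableType μ.1) (ht : CountablyTight (RadonProb K))
    {𝒞 : Set (Set C(K, ℝ))} (h𝒞 : CIP 𝒞) {ε : ℝ} (hε : 0 < ε) :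
    ∃ x, ∀ 𝒟 ⊆ 𝒞, 𝒟.Countable → ∃ y ∈ ⋂₀ 𝒟, ‖y - x‖ < ε := by
  by_contra! hcon
  choose D hD hDc hDd using hcon
  have step : ∀ G : {G : Set C(K, ℝ) // G.Countable}, ∃ 𝒟 ⊆ 𝒞, 𝒟.Countable ∧
      ∃ F : (C(K, ℝ) × C(K, ℝ)) →ₗ[ℝ] ℝ, ∃ μ : RadonProb K, (∀ w, 0 ≤ w → 0 ≤ F w) ∧
      (∀ g, μ.L g = F (g, g)) ∧
      (∀ x ∈ G.1, F (x, -x) = 0) ∧ ∀ y ∈ ⋂₀ 𝒟, ε ≤ F (y, -y) := by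
    rintro ⟨G, hG⟩
    obtain ⟨c, hc, hc'⟩ := hG.isSeparable.span (R := ℝ)
    have hsub : (⋃ x ∈ c, D x) ⊆ 𝒞 := iUnion₂_subset fun x _ => hD x
    have hcount : (⋃ x ∈ c, D x).Countable := hc.biUnion fun x _ => hDc x
    obtain ⟨F, hF1, hF2, hF3, hF4⟩ := exists_state_s17 (Submodule.span ℝ G) (⋂₀ (⋃ x ∈ c, D x))
      (convex_sInter fun C hC => (h𝒞.1 C (hsub hC)).2) (h𝒞.2 _ hsub hcount) ε hε (by
        intro x hx y hy
        have hcl : IsClosed {x | ε ≤ ‖y - x‖} := isClosed_le continuous_const (by fun_prop)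
        refine closure_minimal (fun x' hx' => ?_) hcl (hc' hx)
        exact hDd x' y (sInter_subset_sInter (subset_biUnion_of_mem (u := D) hx') hy))
    obtain ⟨μ, hμ⟩ := exists_radon (F ∘ₗ (LinearMap.id.prod LinearMap.id))
      (fun g hg => hF1 _ ⟨hg, hg⟩) hF2
    exact ⟨_, hsub, hcount, F, μ, hF1, hμ, fun x hx => hF3 x (Submodule.subset_span hx), hF4⟩
  choose 𝒟 h𝒟 h𝒟c F μ hF hμ hFG hFy using step
  haveI : Nonempty {G : Set C(K, ℝ) // G.Countable} := ⟨⟨∅, countable_empty⟩⟩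
  haveI : IsDirectedOrder {G : Set C(K, ℝ) // G.Countable} :=
    ⟨fun a b => ⟨⟨a.1 ∪ b.1, a.2.union b.2⟩, subset_union_left, subset_union_right⟩⟩
  obtain ⟨l, hl⟩ := exists_clusterPt_of_compactSpace (Filter.map μ Filter.atTop)
  obtain ⟨G, hG, hGd⟩ := l.exists_countable_dense (h l)
  have hcl : l ∈ closure (μ '' Ici ⟨G, hG⟩) := by
    rw [mem_closure_iff_clusterPt]
    exact hl.mono (Filter.le_principal_iff.2 (Filter.image_mem_map (Filter.Ici_mem_atTop _)))
  obtain ⟨B, hB, hBc, hlB⟩ := ht _ l hcl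
  choose! s hs hs' using (fun ν (hν : ν ∈ B) => hB hν)
  obtain ⟨y, hy⟩ := h𝒞.2 (⋃ ν ∈ B, 𝒟 (s ν)) (iUnion₂_subset fun ν _ => h𝒟 _) (hBc.biUnion fun ν _ => h𝒟c _)
  obtain ⟨g, hg, hlg⟩ := hGd y ε hε
  obtain ⟨ν, hν, hνg⟩ := exists_mem_lt hlB _ hlg
  have h1 := hFy (s ν) y (sInter_subset_sInter (subset_biUnion_of_mem (u := fun ν => 𝒟 (s ν)) hν) hy)
  have h2 := hFG (s ν) g (hs ν hν hg)
  have h3 := hμ (s ν) |y - g|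
  rw [hs' ν hν] at h3
  have h4 : 0 ≤ F (s ν) ((|y - g|, |y - g|) - ((y, -y) - (g, -g))) := by
    refine hF _ _ ⟨?_, ?_⟩
    · exact sub_nonneg.2 (le_abs_self (y - g))
    · refine sub_nonneg.2 (le_trans (le_of_eq ?_) (neg_le_abs (y - g)))
      ext; simp; ring
  rw [map_sub, map_sub] at h4
  linarith

lemma C_of_tight (h : ∀ μ : RadonProb K, HasCountableType μ.1) (ht : CountablyTight (RadonProb K)) :
    PropertyC C(K, ℝ) := by
  intro 𝒞 h1 h2
  have step : ∀ (𝒢 : {𝒢 : Set (Set C(K, ℝ)) // CIP 𝒢}) (n : ℕ), ∃ x,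
      CIP (insert (Metric.closedBall x ((1 / 2 : ℝ) ^ n)) 𝒢.1) := by
    rintro ⟨𝒢, h𝒢⟩ n
    obtain ⟨x, hx⟩ := key_step h ht h𝒢 (ε := (1 / 2 : ℝ) ^ n) (by positivity)
    refine ⟨x, ?_, fun 𝒟 h𝒟 hc => ?_⟩
    · rintro C (rfl | hC)
      · exact ⟨Metric.isClosed_closedBall, convex_closedBall _ _⟩
      · exact h𝒢.1 C hC
    · obtain ⟨y, hy, hyx⟩ := hx (𝒟 ∩ 𝒢) inter_subset_right (hc.mono inter_subset_left)
      refine ⟨y, fun C hC => ?_⟩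
      rcases h𝒟 hC with rfl | hC'
      · rw [Metric.mem_closedBall, dist_eq_norm]
        exact hyx.le
      · exact hy C ⟨hC, hC'⟩
  choose x hx using step
  let 𝒢 : ℕ → {𝒢 : Set (Set C(K, ℝ)) // CIP 𝒢} := fun n =>
    Nat.rec ⟨𝒞, h1, h2⟩ (fun n g => ⟨_, hx g n⟩) n
  have hsucc : ∀ n, (𝒢 (n + 1)).1 = insert (Metric.closedBall (x (𝒢 n) n) ((1 / 2 : ℝ) ^ n)) (𝒢 n).1 :=
    fun n => rfl
  have hmono : Monotone fun n => (𝒢 n).1 := monotone_nat_of_le_succ fun n => by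
    rw [hsucc]; exact subset_insert _ _
  let a : ℕ → C(K, ℝ) := fun n => x (𝒢 n) n
  have hball : ∀ n, Metric.closedBall (a n) ((1 / 2 : ℝ) ^ n) ∈ (𝒢 (n + 1)).1 := fun n => by
    rw [hsucc]; exact mem_insert _ _
  have hpair : ∀ n, ∀ P ∈ (𝒢 n).1, ∀ Q ∈ (𝒢 n).1, (P ∩ Q).Nonempty := fun n P hP Q hQ => by
    have := (𝒢 n).2.2 {P, Q} (by rintro _ (rfl | rfl) <;> assumption) (by simp)
    simpa using this
  have hcau : CauchySeq a := by
    refine cauchySeq_of_le_geometric (1 / 2 : ℝ) 2 (by norm_num) fun n => ?_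
    obtain ⟨z, hz1, hz2⟩ := hpair (n + 2) _ (hmono (Nat.le_succ (n + 1)) (hball n)) _ (hball (n + 1))
    have e1 := Metric.mem_closedBall'.1 hz1
    have e2 := Metric.mem_closedBall.1 hz2
    have := dist_triangle (a n) z (a (n + 1))
    rw [pow_succ] at e2
    have : (0 : ℝ) < (1 / 2) ^ n := by positivity
    linarith
  obtain ⟨z, hz⟩ := cauchySeq_tendsto_of_complete hcau
  refine ⟨z, fun C hC => ?_⟩
  have : ∀ n, ∃ y ∈ C, dist (a n) y ≤ (1 / 2 : ℝ) ^ n := fun n => by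
    obtain ⟨y, hy1, hy2⟩ := hpair (n + 1) C (hmono (Nat.zero_le (n + 1)) hC) _ (hball n)
    exact ⟨y, hy1, Metric.mem_closedBall'.1 hy2⟩
  choose y hy hy' using this
  refine (h1 C hC).1.mem_of_tendsto (hz.congr_dist ?_) (Filter.Eventually.of_forall hy)
  exact squeeze_zero (fun _ => dist_nonneg) hy'
    (tendsto_pow_atTop_nhds_zero_of_lt_one (by norm_num) (by norm_num))
end

/-- If every Radon probability measure on `K` has countable Maharam type, then `P(K)` has
countable tightness iff `C(K)` has property (C) of Corson. -/
theorem stmt17 (K : Type*) [TopologicalSpace K] [CompactSpace K] [T2Space K]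
    (h : ∀ μ : RadonProb K, HasCountableType μ.1) :
    CountablyTight (RadonProb K) ↔ PropertyC C(K, ℝ) := by
  exact ⟨C_of_tight h, tight_of_C h⟩
end
end
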